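/- arXiv:1802.05724 — 2 statements merged into one kernel-verified Lean document; each statement's English description precedes it below -/
import Mathlib

section
/- Let p>1, Q>1 and set p1 = -1/(p-1). Let q satisfy 1 - s⁻_{p1}(Q) < q < ∞. Then there is a constant C = C(p,q,Q), independent of the dimension n and of the measure μ, such that: for every n ≥ 1, every Radon measure μ on ℝⁿ with μ(H) = 0 for every hyperplane H orthogonal to one of the coordinate axes, and every weight w (a μ-a.e. positive measurable function) with strong Muckenhoupt characteristic [w]_p ≤ Q, one has [w]_q ≤ C; in particular w belongs to the strong Muckenhoupt class A_q* with respect to μ. -/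
open MeasureTheory Set Filter

noncomputable section

/-- An axis-parallel open rectangular box in `ℝⁿ` (modelled as `Fin n → ℝ`). -/
def IsBox {n : ℕ} (R : Set (Fin n → ℝ)) : Prop :=
  ∃ a b : Fin n → ℝ, (∀ i, a i < b i) ∧ R = univ.pi fun i => Ioo (a i) (b i)

/-- The average `⟨f⟩_R = (1/μ(R)) ∫_R f dμ`. -/
def boxAvg {n : ℕ} (μ : Measure (Fin n → ℝ)) (R : Set (Fin n → ℝ))
    (f : (Fin n → ℝ) → ℝ) : ℝ :=
  ⨍ x in R, f x ∂μ

/-- Every hyperplane orthogonal to one of the coordinate axes is `μ`-null. -/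
def NullHyperplanes {n : ℕ} (μ : Measure (Fin n → ℝ)) : Prop :=
  ∀ (i : Fin n) (c : ℝ), μ {x | x i = c} = 0

/-- `[w]_p ≤ Q`: the strong Muckenhoupt characteristic of `w` w.r.t. `μ` is at most `Q`;
this includes the requisite integrability of `w` and `w^{-1/(p-1)}` on every box. -/
def ApBound {n : ℕ} (μ : Measure (Fin n → ℝ)) (w : (Fin n → ℝ) → ℝ) (p Q : ℝ) : Prop :=
  ∀ R : Set (Fin n → ℝ), IsBox R → 0 < μ R → μ R < ⊤ →
    IntegrableOn w R μ ∧ IntegrableOn (fun x => w x ^ (-1 / (p - 1))) R μ ∧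
    boxAvg μ R w * (boxAvg μ R fun x => w x ^ (-1 / (p - 1))) ^ (p - 1) ≤ Q

/-- `[w]_{RH_p} ≤ Q`: the strong Reverse Hölder characteristic of `w` w.r.t. `μ` is
at most `Q`, i.e. `⟨w^p⟩_R^{1/p} ≤ Q⟨w⟩_R` on every box. -/
def RHBound {n : ℕ} (μ : Measure (Fin n → ℝ)) (w : (Fin n → ℝ) → ℝ) (p Q : ℝ) : Prop :=
  ∀ R : Set (Fin n → ℝ), IsBox R → 0 < μ R → μ R < ⊤ →
    IntegrableOn w R μ ∧ IntegrableOn (fun x => w x ^ p) R μ ∧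
    (boxAvg μ R fun x => w x ^ p) ^ (1 / p) ≤ Q * boxAvg μ R w

/-- The open coordinate box with corners `a` and `b` (empty if `b i ≤ a i` for some `i`). -/
def openBox {n : ℕ} (a b : Fin n → ℝ) : Set (Fin n → ℝ) :=
  univ.pi fun i => Ioo (a i) (b i)

section Boxes

variable {n : ℕ} {μ : Measure (Fin n → ℝ)} {f : (Fin n → ℝ) → ℝ} {a b : Fin n → ℝ} {i : Fin n}
  {s : ℝ}

theorem mem_openBox {x : Fin n → ℝ} : x ∈ openBox a b ↔ ∀ i, a i < x i ∧ x i < b i := by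
  simp [openBox]

theorem measurableSet_openBox : MeasurableSet (openBox a b) :=
  MeasurableSet.univ_pi fun _ => measurableSet_Ioo

theorem openBox_update_right (hs : s ≤ b i) :
    openBox a (Function.update b i s) = openBox a b ∩ {x | x i < s} := by
  ext x
  simp only [mem_openBox, mem_inter_iff, mem_ofPred_eq]
  constructor
  · intro h
    have hi := h i
    rw [Function.update_self] at hi
    refine ⟨fun j => ⟨(h j).1, ?_⟩, hi.2⟩
    by_cases hj : j = i
    · subst hj; exact hi.2.trans_le hs
    · simpa [hj] using (h j).2
  · rintro ⟨h, hi⟩ j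
    refine ⟨(h j).1, ?_⟩
    by_cases hj : j = i
    · subst hj; simpa using hi
    · simpa [hj] using (h j).2

theorem openBox_update_left (hs : a i ≤ s) :
    openBox (Function.update a i s) b = openBox a b ∩ {x | s < x i} := by
  ext x
  simp only [mem_openBox, mem_inter_iff, mem_ofPred_eq]
  constructor
  · intro h
    have hi := h i
    rw [Function.update_self] at hi
    refine ⟨fun j => ⟨?_, (h j).2⟩, hi.1⟩
    by_cases hj : j = i
    · subst hj; exact hs.trans_lt hi.1
    · simpa [hj] using (h j).1
  · rintro ⟨h, hi⟩ j
    refine ⟨?_, (h j).2⟩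
    by_cases hj : j = i
    · subst hj; simpa using hi
    · simpa [hj] using (h j).1

theorem measure_openBox_lt_top [IsLocallyFiniteMeasure μ] : μ (openBox a b) < ⊤ := by
  refine (measure_mono (?_ : openBox a b ⊆ Icc a b)).trans_lt isCompact_Icc.measure_lt_top
  intro x hx
  rw [mem_openBox] at hx
  exact ⟨fun i => (hx i).1.le, fun i => (hx i).2.le⟩

theorem setIntegral_openBox_split (hμ : NullHyperplanes μ)
    (hf : IntegrableOn f (openBox a b) μ) (has : a i ≤ s) (hsb : s ≤ b i) :
    ∫ x in openBox a b, f x ∂μ = ∫ x in openBox a (Function.update b i s), f x ∂μ +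
      ∫ x in openBox (Function.update a i s) b, f x ∂μ := by
  rw [openBox_update_right hsb, openBox_update_left has,
    ← integral_inter_add_sdiff (measurableSet_lt (measurable_pi_apply i) measurable_const) hf]
  congr 1
  refine setIntegral_congr_set ?_
  have h0 : ∀ᵐ x ∂μ, x i ≠ s := by
    rw [ae_iff]; simpa using hμ i s
  filter_upwards [h0] with x hx
  refine propext (and_congr_right fun _ => ?_)
  change ¬ (x i < s) ↔ s < x i
  exact ⟨fun h => lt_of_le_of_ne (not_lt.1 h) (Ne.symm hx), fun h => not_lt.2 h.le⟩

theorem continuous_setIntegral_inter_lt (hμ : NullHyperplanes μ) {P : Set (Fin n → ℝ)}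
    (hf : IntegrableOn f P μ) (i : Fin n) :
    Continuous fun s : ℝ => ∫ x in P ∩ {x | x i < s}, f x ∂μ := by
  have hm (s : ℝ) : MeasurableSet {x : Fin n → ℝ | x i < s} :=
    measurableSet_lt (measurable_pi_apply i) measurable_const
  have h1 : (fun s : ℝ => ∫ x in P ∩ {x | x i < s}, f x ∂μ) =
      fun s : ℝ => ∫ x in P, {x : Fin n → ℝ | x i < s}.indicator f x ∂μ := by
    funext s
    rw [setIntegral_indicator (hm s)]
  rw [h1, continuous_iff_continuousAt]
  intro s
  refine continuousAt_of_dominated (bound := fun x => ‖f x‖)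
    (Eventually.of_forall fun r => hf.aestronglyMeasurable.indicator (hm r))
    (Eventually.of_forall fun r => Eventually.of_forall fun x => norm_indicator_le_norm_self _ _)
    hf.norm ?_
  have h0 : ∀ᵐ x ∂μ, x i ≠ s := by
    rw [ae_iff]; simpa using hμ i s
  filter_upwards [ae_restrict_of_ae h0] with x hx
  have hev : ∀ᶠ r in nhds s, (x i < r ↔ x i < s) := by
    rcases lt_or_gt_of_ne hx with h | h
    · filter_upwards [lt_mem_nhds h] with r hr
      exact iff_of_true hr h
    · filter_upwards [gt_mem_nhds h] with r hr
      exact iff_of_false hr.not_gt h.not_gt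
  refine (continuousAt_const (y := {x : Fin n → ℝ | x i < s}.indicator f x)).congr ?_
  filter_upwards [hev] with r hr
  simp only [indicator, mem_ofPred_eq, hr]

/-- A stopping-time argument: a box on which `f` has nonpositive integral is cut repeatedly into
boxes on which `f` has zero integral and small boxes on which `f` has nonpositive integral. -/
theorem setIntegral_openBox_nonneg_of_small (hμ : NullHyperplanes μ) {G : (Fin n → ℝ) → ℝ}
    (hf : ∀ a b, IntegrableOn f (openBox a b) μ) (hG : ∀ a b, IntegrableOn G (openBox a b) μ)
    (hzero : ∀ a b, ∫ x in openBox a b, f x ∂μ = 0 → 0 ≤ ∫ x in openBox a b, G x ∂μ)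
    {δ : ℝ} (hδ : 0 < δ)
    (hsmall : ∀ a b, (∀ i, b i - a i ≤ δ) → ∫ x in openBox a b, f x ∂μ ≤ 0 →
      0 ≤ ∫ x in openBox a b, G x ∂μ)
    (a b : Fin n → ℝ) (hab : ∫ x in openBox a b, f x ∂μ ≤ 0) :
    0 ≤ ∫ x in openBox a b, G x ∂μ := by
  have key : ∀ m : ℕ, ∀ k : Fin n → ℕ, ∑ i, k i = m → ∀ a b : Fin n → ℝ,
      (∀ i, b i - a i ≤ δ * 2 ^ k i) → ∫ x in openBox a b, f x ∂μ ≤ 0 →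
      0 ≤ ∫ x in openBox a b, G x ∂μ := by
    intro m
    induction m with
    | zero =>
      intro k hk a b hlen h
      refine hsmall a b (fun i => ?_) h
      have : k i = 0 := by
        have := Finset.sum_eq_zero_iff.1 hk i (Finset.mem_univ i)
        exact this
      simpa [this] using hlen i
    | succ m ih =>
      intro k hk a b hlen h
      obtain ⟨i, hi⟩ : ∃ i, k i ≠ 0 := by
        by_contra! h0
        simp [h0] at hk
      by_cases hlt : b i ≤ a i
      · have : openBox a b = ∅ := by
          ext x
          simp only [mem_openBox, mem_empty_iff_false, iff_false, not_forall]
          exact ⟨i, fun hx => by linarith [hx.1, hx.2]⟩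
        simp [this]
      push Not at hlt
      obtain ⟨l, hl⟩ := Nat.exists_eq_succ_of_ne_zero hi
      have hsum : ∑ j, Function.update k i l j = m := by
        have h1 := Finset.add_sum_erase Finset.univ k (Finset.mem_univ i)
        have h2 := Finset.add_sum_erase Finset.univ (Function.update k i l) (Finset.mem_univ i)
        have h3 : ∑ j ∈ Finset.univ.erase i, Function.update k i l j =
            ∑ j ∈ Finset.univ.erase i, k j :=
          Finset.sum_congr rfl fun j hj => by simp [Finset.ne_of_mem_erase hj]
        rw [Function.update_self] at h2
        omega
      have hhalf : (b i - a i) / 2 ≤ δ * 2 ^ l := by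
        have := hlen i
        rw [hl, pow_succ] at this
        linarith
      have hleft (s : ℝ) (hs : s ≤ (a i + b i) / 2) (j : Fin n) :
          Function.update b i s j - a j ≤ δ * 2 ^ Function.update k i l j := by
        by_cases hj : j = i
        · subst hj; simp only [Function.update_self]; linarith
        · simpa [hj] using hlen j
      have hright (s : ℝ) (hs : (a i + b i) / 2 ≤ s) (j : Fin n) :
          b j - Function.update a i s j ≤ δ * 2 ^ Function.update k i l j := by
        by_cases hj : j = i
        · subst hj; simp only [Function.update_self]; linarith
        · simpa [hj] using hlen j
      have hcont : Continuous fun s : ℝ => ∫ x in openBox a b ∩ {x | x i < s}, f x ∂μ :=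
        continuous_setIntegral_inter_lt hμ (hf a b) i
      have hsplitf (s : ℝ) (h1 : a i ≤ s) (h2 : s ≤ b i) :=
        setIntegral_openBox_split (s := s) hμ (hf a b) h1 h2
      have hsplitG (s : ℝ) (h1 : a i ≤ s) (h2 : s ≤ b i) :=
        setIntegral_openBox_split (s := s) hμ (hG a b) h1 h2
      have hmid1 : a i ≤ (a i + b i) / 2 := by linarith
      have hmid2 : (a i + b i) / 2 ≤ b i := by linarith
      by_cases hL : 0 < ∫ x in openBox a (Function.update b i ((a i + b i) / 2)), f x ∂μ
      · obtain ⟨s, hs, hs0⟩ : (0 : ℝ) ∈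
            (fun s : ℝ => ∫ x in openBox a b ∩ {x | x i < s}, f x ∂μ) ''
              Icc ((a i + b i) / 2) (b i) := by
          refine intermediate_value_Icc' hmid2 hcont.continuousOn ⟨?_, ?_⟩
          · change ∫ x in openBox a b ∩ {x | x i < b i}, f x ∂μ ≤ 0
            rw [← openBox_update_right le_rfl, Function.update_eq_self]
            exact h
          · change 0 ≤ ∫ x in openBox a b ∩ {x | x i < (a i + b i) / 2}, f x ∂μ
            rw [← openBox_update_right hmid2]
            exact hL.le
        replace hs0 : ∫ x in openBox a b ∩ {x | x i < s}, f x ∂μ = 0 := hs0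
        rw [← openBox_update_right hs.2] at hs0
        have has : a i ≤ s := hmid1.trans hs.1
        rw [hsplitG s has hs.2]
        rw [hsplitf s has hs.2, hs0, zero_add] at h
        exact add_nonneg (hzero _ _ hs0) (ih _ hsum _ _ (hright s hs.1) h)
      by_cases hR : 0 < ∫ x in openBox (Function.update a i ((a i + b i) / 2)) b, f x ∂μ
      · obtain ⟨s, hs, hs0⟩ : (∫ x in openBox a b, f x ∂μ) ∈
            (fun s : ℝ => ∫ x in openBox a b ∩ {x | x i < s}, f x ∂μ) ''
              Icc (a i) ((a i + b i) / 2) := by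
          refine intermediate_value_Icc' hmid1 hcont.continuousOn ⟨?_, ?_⟩
          · change ∫ x in openBox a b ∩ {x | x i < (a i + b i) / 2}, f x ∂μ ≤ _
            rw [← openBox_update_right hmid2, hsplitf _ hmid1 hmid2]
            linarith
          · change _ ≤ ∫ x in openBox a b ∩ {x | x i < a i}, f x ∂μ
            have : openBox a b ∩ {x | x i < a i} = ∅ := by
              ext x
              simp only [mem_inter_iff, mem_openBox, mem_ofPred_eq, mem_empty_iff_false, iff_false]
              exact fun hx => by linarith [(hx.1 i).1, hx.2]
            rw [this]
            simpa using h
        replace hs0 :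
            ∫ x in openBox a b ∩ {x | x i < s}, f x ∂μ = ∫ x in openBox a b, f x ∂μ := hs0
        have hsb : s ≤ b i := hs.2.trans hmid2
        rw [← openBox_update_right hsb] at hs0
        have h0 : ∫ x in openBox (Function.update a i s) b, f x ∂μ = 0 := by
          linarith [hsplitf s hs.1 hsb]
        rw [hsplitG s hs.1 hsb]
        exact add_nonneg (ih _ hsum _ _ (hleft s hs.2) (hs0.trans_le h)) (hzero _ _ h0)
      rw [hsplitG _ hmid1 hmid2]
      exact add_nonneg (ih _ hsum _ _ (hleft _ le_rfl) (not_lt.1 hL))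
        (ih _ hsum _ _ (hright _ le_rfl) (not_lt.1 hR))
  have hk : ∀ i, ∃ k : ℕ, b i - a i ≤ δ * 2 ^ k := by
    intro i
    obtain ⟨k, hk⟩ := pow_unbounded_of_one_lt ((b i - a i) / δ) one_lt_two
    exact ⟨k, by rw [div_lt_iff₀ hδ] at hk; linarith⟩
  choose k hk using hk
  exact key _ k rfl a b hk hab

/-- If `g` oscillates by at most `ε` on a set `P` where `f` has nonpositive integral, then the
positive part of `f` is controlled in `L¹(P)` by the distance from `f` to `g`. -/
theorem setIntegral_max_zero_le_of_oscillation {P : Set (Fin n → ℝ)} (hP : MeasurableSet P)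
    (hPfin : μ P < ⊤) {g : (Fin n → ℝ) → ℝ} (hf : IntegrableOn f P μ) (hg : IntegrableOn g P μ)
    {ε : ℝ} (hosc : ∀ x ∈ P, ∀ y ∈ P, g x ≤ g y + ε) (hε : 0 ≤ ε)
    (h : ∫ x in P, f x ∂μ ≤ 0) :
    ∫ x in P, max (f x) 0 ∂μ ≤ ∫ x in P, (2 * |f x - g x| + ε) ∂μ := by
  have : IsFiniteMeasure (μ.restrict P) := ⟨by simpa using hPfin⟩
  have hfg : IntegrableOn (fun x => |f x - g x|) P μ := (hf.sub hg).abs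
  rcases eq_or_ne (μ P) 0 with h0 | h0
  · simp [Measure.restrict_eq_zero.2 h0]
  have hpos : 0 < μ.real P := ENNReal.toReal_pos h0 hPfin.ne
  set I := ∫ x in P, |f x - g x| ∂μ with hI
  have hI0 : 0 ≤ I := integral_nonneg fun x => abs_nonneg _
  have hgx : ∀ x ∈ P, g x ≤ I / μ.real P + ε := by
    intro x hx
    have h1 : ∫ y in P, g x ∂μ ≤ ∫ y in P, (f y + |f y - g y| + ε) ∂μ := by
      refine setIntegral_mono_on (integrable_const _)
        ((hf.add hfg).add (integrable_const _)) hP fun y hy => ?_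
      linarith [hosc x hx y hy, neg_abs_le (f y - g y)]
    rw [integral_add (f := fun y => f y + |f y - g y|) (hf.add hfg) (integrable_const _),
      integral_add hf hfg] at h1
    simp only [integral_const, smul_eq_mul, measureReal_restrict_apply_univ] at h1
    rw [← sub_le_iff_le_add, le_div_iff₀ hpos]
    nlinarith
  have h2 : ∫ x in P, max (f x) 0 ∂μ ≤ ∫ x in P, (|f x - g x| + (I / μ.real P + ε)) ∂μ := by
    refine setIntegral_mono_on hf.pos_part (hfg.add (integrable_const _)) hP fun x hx => ?_
    have := hgx x hx
    have h3 : 0 ≤ I / μ.real P := by positivity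
    exact max_le (by linarith [le_abs_self (f x - g x)]) (by positivity)
  refine h2.trans_eq ?_
  rw [integral_add hfg (integrable_const _), integral_add (hfg.const_mul 2) (integrable_const _),
    integral_const_mul]
  simp only [integral_const, smul_eq_mul, measureReal_restrict_apply_univ]
  rw [mul_add, mul_div_cancel₀ _ hpos.ne']
  ring

theorem setIntegral_openBox_nonneg [IsLocallyFiniteMeasure μ] (hμ : NullHyperplanes μ)
    {K : (Fin n → ℝ) → ℝ}
    (hf : ∀ a b, IntegrableOn f (openBox a b) μ) (hK : ∀ a b, IntegrableOn K (openBox a b) μ)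
    (hzero : ∀ a b, ∫ x in openBox a b, f x ∂μ = 0 → 0 ≤ ∫ x in openBox a b, K x ∂μ)
    {C : ℝ} (hC : 0 ≤ C) (hKf : ∀ᵐ x ∂μ, -(C * max (f x) 0) ≤ K x)
    (a b : Fin n → ℝ) (hab : ∫ x in openBox a b, f x ∂μ ≤ 0) :
    0 ≤ ∫ x in openBox a b, K x ∂μ := by
  have hfin (a b : Fin n → ℝ) : IsFiniteMeasure (μ.restrict (openBox a b)) :=
    ⟨by simpa using measure_openBox_lt_top⟩
  suffices H : ∀ ε > 0, -(C * (2 * ε + μ.real (openBox a b) * ε)) ≤ ∫ x in openBox a b, K x ∂μ by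
    have hlim : Tendsto (fun ε : ℝ => -(C * (2 * ε + μ.real (openBox a b) * ε)))
        (nhdsWithin 0 (Ioi 0)) (nhds 0) := by
      have : Continuous fun ε : ℝ => -(C * (2 * ε + μ.real (openBox a b) * ε)) := by fun_prop
      simpa using (this.tendsto 0).mono_left nhdsWithin_le_nhds
    exact le_of_tendsto hlim (eventually_mem_nhdsWithin.mono fun ε hε => H ε hε)
  intro ε hε
  obtain ⟨g, hgc, hg, hgcont, -⟩ :=
    (hf a b).exists_hasCompactSupport_integral_sub_le hε
  have hgint (a b : Fin n → ℝ) : IntegrableOn g (openBox a b) μ :=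
    (hgcont.integrable_of_hasCompactSupport hgc).integrableOn
  obtain ⟨δ, hδ, hgδ⟩ := Metric.uniformContinuous_iff.1
    (hgc.uniformContinuous_of_continuous hgcont) ε hε
  have hfg (a b : Fin n → ℝ) : IntegrableOn (fun x => |f x - g x|) (openBox a b) μ :=
    ((hf a b).sub (hgint a b)).abs
  have hE (a b : Fin n → ℝ) :
      IntegrableOn (fun x => C * (2 * |f x - g x| + ε)) (openBox a b) μ :=
    (((hfg a b).const_mul 2).add (integrable_const _)).const_mul C
  have main := setIntegral_openBox_nonneg_of_small hμ
    (G := fun x => K x + C * (2 * |f x - g x| + ε)) hf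
    (fun a b => (hK a b).add (hE a b)) (fun a b h => ?_) (half_pos hδ) (fun a b hlen h => ?_)
    a b hab
  · rw [integral_add (hK a b) (hE a b), integral_const_mul, integral_add
      ((hfg a b).const_mul 2) (integrable_const _), integral_const_mul] at main
    simp only [integral_const, smul_eq_mul, measureReal_restrict_apply_univ] at main
    have : ∫ x in openBox a b, |f x - g x| ∂μ ≤ ε := hg
    nlinarith
  · rw [integral_add (hK a b) (hE a b)]
    exact add_nonneg (hzero a b h) (integral_nonneg fun x => by positivity)
  · rw [integral_add (hK a b) (hE a b), integral_const_mul]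
    have h1 := setIntegral_max_zero_le_of_oscillation measurableSet_openBox
      measure_openBox_lt_top (hf a b) (hgint a b) (fun x hx y hy => ?_) hε.le h
    · have h2 : ∫ x in openBox a b, -(C * max (f x) 0) ∂μ ≤ ∫ x in openBox a b, K x ∂μ :=
        integral_mono_ae ((hf a b).pos_part.const_mul C).neg (hK a b) (ae_restrict_of_ae hKf)
      rw [integral_neg, integral_const_mul] at h2
      nlinarith [mul_le_mul_of_nonneg_left h1 hC]
    · have hd : dist x y < δ := by
        refine lt_of_le_of_lt ((dist_pi_le_iff (half_pos hδ).le).2 fun i => ?_) (half_lt_self hδ)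
        rw [mem_openBox] at hx hy
        rw [Real.dist_eq, abs_le]
        constructor <;> linarith [hlen i, (hx i).1, (hx i).2, (hy i).1, (hy i).2]
      have := hgδ hd
      rw [Real.dist_eq] at this
      linarith [le_abs_self (g x - g y)]

end Boxes

/-- The tangent line to the convex function `y ↦ y ^ (1 - p)` at `d` lies below its graph. -/
theorem tangent_le_rpow_one_sub {p y d : ℝ} (hp : 1 ≤ p) (hy : 0 < y) (hd : 0 < d) :
    d ^ (-p) * (p * d - (p - 1) * y) ≤ y ^ (1 - p) := by
  have h1 := one_add_mul_self_le_rpow_one_add (s := d / y - 1) (by linarith [div_pos hd hy]) hp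
  rw [add_sub_cancel, Real.div_rpow hd.le hy.le] at h1
  have h2 : y ^ (1 - p) = y / y ^ p := by rw [Real.rpow_sub hy, Real.rpow_one]
  rw [Real.rpow_neg hd.le, h2, inv_mul_le_iff₀ (by positivity)]
  calc p * d - (p - 1) * y = y * (1 + p * (d / y - 1)) := by field_simp; ring
    _ ≤ y * (d ^ p / y ^ p) := by gcongr
    _ = d ^ p * (y / y ^ p) := by ring

section Chord

variable {p Q c y : ℝ}

theorem chord_le_rpow_one_sub (hp : 1 < p) (hQ : 1 < Q) (hc0 : 0 < c) (hc1 : c < 1)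
    (hc : c ^ (1 - p) = Q * (p - (p - 1) * c)) (hy : 0 < y) (hyc : y ≤ c) :
    Q * (p - (p - 1) * y) ≤ y ^ (1 - p) := by
  refine le_trans ?_ (tangent_le_rpow_one_sub hp.le hy hc0)
  have h1 : c ^ (-p) = Q * (p - (p - 1) * c) / c := by
    rw [← hc, ← Real.rpow_sub_one hc0.ne']; ring_nf
  rw [h1, div_mul_eq_mul_div, le_div_iff₀ hc0]
  have h2 : 0 ≤ Q * (p * (p - 1) * (1 - c) * (c - y)) := by
    have := sub_nonneg.2 hyc
    have := sub_pos.2 hp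
    have := sub_pos.2 hc1
    positivity
  linear_combination h2

theorem rpow_one_sub_le_chord (hp : 1 < p) (hQ : 1 < Q) (hc0 : 0 < c)
    (hc : c ^ (1 - p) = Q * (p - (p - 1) * c)) (hcy : c ≤ y) (hy1 : y ≤ 1) :
    y ^ (1 - p) ≤ Q * (p - (p - 1) * y) := by
  have hy : 0 < y := hc0.trans_le hcy
  have h1 := tangent_le_rpow_one_sub hp.le hc0 hy
  have h2 : y ^ (-p) = y ^ (1 - p) / y := by
    rw [← Real.rpow_sub_one hy.ne']; ring_nf
  have hpos : 0 < p * y - (p - 1) * c := by nlinarith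
  rw [h2, hc, div_mul_eq_mul_div, div_le_iff₀ hy, ← le_div_iff₀ hpos] at h1
  refine h1.trans ?_
  rw [div_le_iff₀ hpos]
  have h3 : 0 ≤ Q * (p * (p - 1) * (y - c) * (1 - y)) := by
    have := sub_nonneg.2 hcy
    have := sub_pos.2 hp
    have := sub_nonneg.2 hy1
    positivity
  linear_combination h3

end Chord

/-- The test kernel, with value zero where `s < c * α`; the variable `u` stands for
`s ^ (1 - p)`. -/
def testKernel (p Q c s u α : ℝ) : ℝ :=
  if c * α ≤ s then Q * (p - (p - 1) * (s / α)) - u * α ^ (p - 1) else 0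

section Kernel

variable {p Q c s α : ℝ}

theorem div_rpow_one_sub (hs : 0 < s) (hα : 0 < α) :
    (s / α) ^ (1 - p) = s ^ (1 - p) * α ^ (p - 1) := by
  rw [Real.div_rpow hs.le hα.le, div_eq_mul_inv, ← Real.rpow_neg hα.le, neg_sub]

theorem le_testKernel (hp : 1 < p) (hQ : 1 < Q) (hc0 : 0 < c) (hc1 : c < 1)
    (hc : c ^ (1 - p) = Q * (p - (p - 1) * c)) (hs : 0 < s) (hα : 0 < α) :
    Q * (p - (p - 1) * (s / α)) - s ^ (1 - p) * α ^ (p - 1) ≤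
      testKernel p Q c s (s ^ (1 - p)) α := by
  unfold testKernel
  split_ifs with h
  · exact le_rfl
  · rw [← div_rpow_one_sub hs hα, sub_nonpos]
    refine chord_le_rpow_one_sub hp hQ hc0 hc1 hc (div_pos hs hα) ?_
    rw [div_le_iff₀ hα]
    exact (not_le.1 h).le

theorem neg_mul_max_le_testKernel (hp : 1 < p) (hQ : 1 < Q) (hc0 : 0 < c)
    (hc : c ^ (1 - p) = Q * (p - (p - 1) * c)) (hs : 0 < s) (hα : 0 < α) :
    -(Q * (p - 1) / α * max (s - α) 0) ≤ testKernel p Q c s (s ^ (1 - p)) α := by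
  have hp' := sub_pos.2 hp
  have hneg : -(Q * (p - 1) / α * max (s - α) 0) ≤ 0 :=
    neg_nonpos.2 (mul_nonneg (by positivity) (le_max_right _ _))
  unfold testKernel
  split_ifs with h
  · rw [← div_rpow_one_sub hs hα]
    rcases le_total s α with hsα | hsα
    · refine hneg.trans (sub_nonneg.2 (rpow_one_sub_le_chord hp hQ hc0 hc ?_ ?_))
      · rwa [le_div_iff₀ hα]
      · exact div_le_one_of_le₀ hsα hα.le
    · have h1 : (s / α) ^ (1 - p) ≤ 1 :=
        Real.rpow_le_one_of_one_le_of_nonpos ((one_le_div hα).2 hsα) (by linarith)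
      rw [max_eq_left (sub_nonneg.2 hsα)]
      have h2 : Q * (p - 1) / α * (s - α) = Q * (p - 1) * (s / α - 1) := by field_simp
      rw [h2]
      linarith
  · exact hneg

end Kernel

section Primitive

variable {p Q c t s u : ℝ}

theorem hasDerivAt_kernelPrimitive {α : ℝ} (hp : 1 < p) (ht : 1 < t) (hα : 0 < α) :
    HasDerivAt (fun β : ℝ => Q * p / t * β ^ t - Q * (p - 1) * s / (t - 1) * β ^ (t - 1) -
        u / (t + p - 1) * β ^ (t + p - 1))
      (Q * p * α ^ (t - 1) - Q * (p - 1) * s * α ^ (t - 2) - u * α ^ (t + p - 2)) α := by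
  have h (r : ℝ) := Real.hasDerivAt_rpow_const (x := α) (p := r) (Or.inl hα.ne')
  refine ((((h t).const_mul (Q * p / t)).sub
    ((h (t - 1)).const_mul (Q * (p - 1) * s / (t - 1)))).sub
    ((h (t + p - 1)).const_mul (u / (t + p - 1)))).congr_deriv ?_
  have h1 : t - 1 ≠ 0 := by linarith
  have h2 : t + p - 1 ≠ 0 := by linarith
  have h3 : t ≠ 0 := by linarith
  rw [show t - 1 - 1 = t - 2 by ring, show t + p - 1 - 1 = t + p - 2 by ring]
  field_simp

theorem continuousOn_kernel_mul_rpow {α₀ N : ℝ} (hα₀ : 0 < α₀) :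
    ContinuousOn (fun α : ℝ => Q * p * α ^ (t - 1) - Q * (p - 1) * s * α ^ (t - 2) -
      u * α ^ (t + p - 2)) (Icc α₀ N) := by
  have h (r : ℝ) : ContinuousOn (fun α : ℝ => α ^ r) (Icc α₀ N) :=
    continuousOn_id.rpow_const fun x hx => Or.inl (hα₀.trans_le hx.1).ne'
  exact (((h _).const_mul _).sub ((h _).const_mul _)).sub ((h _).const_mul _)

theorem testKernel_mul_rpow {α : ℝ} (hα : 0 < α) :
    testKernel p Q c s u α * α ^ (t - 1) = if c * α ≤ s then
      Q * p * α ^ (t - 1) - Q * (p - 1) * s * α ^ (t - 2) - u * α ^ (t + p - 2) else 0 := by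
  unfold testKernel
  split_ifs with h
  · have h1 : α ^ (t - 2) = α ^ (t - 1) / α := by
      rw [← Real.rpow_sub_one hα.ne']; ring_nf
    have h2 : α ^ (t + p - 2) = α ^ (p - 1) * α ^ (t - 1) := by
      rw [← Real.rpow_add hα]; ring_nf
    rw [h1, h2]
    ring
  · simp

theorem setIntegral_testKernel_mul_rpow {α₀ N : ℝ} (hp : 1 < p) (ht : 1 < t) (hc0 : 0 < c)
    (hα₀ : 0 < α₀) (hN : α₀ ≤ N) (hs : c * α₀ ≤ s) :
    ∫ α in Ioc α₀ N, testKernel p Q c s u α * α ^ (t - 1) =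
      (Q * p / t * min N (s / c) ^ t - Q * (p - 1) * s / (t - 1) * min N (s / c) ^ (t - 1) -
        u / (t + p - 1) * min N (s / c) ^ (t + p - 1)) -
      (Q * p / t * α₀ ^ t - Q * (p - 1) * s / (t - 1) * α₀ ^ (t - 1) -
        u / (t + p - 1) * α₀ ^ (t + p - 1)) := by
  have hle : α₀ ≤ min N (s / c) := le_min hN (by rwa [le_div_iff₀' hc0])
  have h1 : ∫ α in Ioc α₀ N, testKernel p Q c s u α * α ^ (t - 1) =
      ∫ α in Ioc α₀ N, (Iic (s / c)).indicator (fun α : ℝ => Q * p * α ^ (t - 1) -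
        Q * (p - 1) * s * α ^ (t - 2) - u * α ^ (t + p - 2)) α := by
    refine setIntegral_congr_fun measurableSet_Ioc fun α hα => ?_
    simp only [testKernel_mul_rpow (hα₀.trans hα.1), indicator, mem_Iic, le_div_iff₀' hc0]
  rw [h1, setIntegral_indicator measurableSet_Iic, Ioc_inter_Iic,
    ← intervalIntegral.integral_of_le hle]
  refine intervalIntegral.integral_eq_sub_of_hasDerivAt
    (f := fun β : ℝ => Q * p / t * β ^ t - Q * (p - 1) * s / (t - 1) * β ^ (t - 1) -
      u / (t + p - 1) * β ^ (t + p - 1)) (fun α hα => ?_) ?_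
  · rw [uIcc_of_le hle] at hα
    exact hasDerivAt_kernelPrimitive hp ht (hα₀.trans_le hα.1)
  · refine ContinuousOn.intervalIntegrable ?_
    rw [uIcc_of_le hle]
    exact continuousOn_kernel_mul_rpow hα₀

theorem kernelPrimitive_eq {α : ℝ} (hs : 0 < s) (hα : 0 < α) :
    Q * p / t * α ^ t - Q * (p - 1) * s / (t - 1) * α ^ (t - 1) -
        s ^ (1 - p) / (t + p - 1) * α ^ (t + p - 1) =
      α ^ t * (Q * p / t - Q * (p - 1) * (s / α) / (t - 1) -
        (s / α) ^ (1 - p) / (t + p - 1)) := by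
  have h1 : α ^ (t - 1) = α ^ t / α := Real.rpow_sub_one hα.ne' t
  have h2 : α ^ (t + p - 1) = α ^ (p - 1) * α ^ t := by
    rw [← Real.rpow_add hα]; ring_nf
  rw [div_rpow_one_sub hs hα, h1, h2]
  ring

theorem kernelPrimitive_nonpos {y : ℝ} (hp : 1 < p) (hQ : 1 < Q) (hc0 : 0 < c) (hc1 : c < 1)
    (hc : c ^ (1 - p) = Q * (p - (p - 1) * c)) (ht : 1 < t) (htc : t * (1 - c) < 1)
    (hy : 0 < y) :
    Q * p / t - Q * (p - 1) * y / (t - 1) - y ^ (1 - p) / (t + p - 1) ≤ 0 := by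
  have ht0 : 0 < t := by linarith
  have ht1 : 0 < t - 1 := by linarith
  have htp : 0 < t + p - 1 := by linarith
  have hd0 : 0 < (t - 1) / t := by positivity
  have hdc : (t - 1) / t ≤ c := by rw [div_le_iff₀ ht0]; linarith
  have h1 := chord_le_rpow_one_sub hp hQ hc0 hc1 hc hd0 hdc
  have h2 := tangent_le_rpow_one_sub hp.le hy hd0
  set d := (t - 1) / t with hd
  have h3 : d ^ (-p) = d ^ (1 - p) / d := by
    rw [← Real.rpow_sub_one hd0.ne']; ring_nf
  have h4 : Q * (t + p - 1) / (t - 1) ≤ d ^ (-p) := by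
    rw [h3, le_div_iff₀ hd0]
    refine le_trans (le_of_eq ?_) h1
    rw [hd]; field_simp; ring
  have h5 : Q * p / t - Q * (p - 1) * y / (t - 1) = Q / (t - 1) * (p * d - (p - 1) * y) := by
    rw [hd]; field_simp
  rw [h5, sub_nonpos, le_div_iff₀ htp]
  rcases le_total (p * d - (p - 1) * y) 0 with h6 | h6
  · have h7 : 0 ≤ y ^ (1 - p) := by positivity
    have h8 : Q / (t - 1) * (p * d - (p - 1) * y) * (t + p - 1) ≤ 0 :=
      mul_nonpos_of_nonpos_of_nonneg (mul_nonpos_of_nonneg_of_nonpos (by positivity) h6) htp.le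
    exact h8.trans h7
  · refine le_trans (le_of_eq ?_) ((mul_le_mul_of_nonneg_right h4 h6).trans h2)
    ring

/-- The gain `κ` and loss `M` are independent of the truncation level `N`. -/
theorem exists_setIntegral_testKernel_le (hp : 1 < p) (hQ : 1 < Q) (hc0 : 0 < c) (hc1 : c < 1)
    (hc : c ^ (1 - p) = Q * (p - (p - 1) * c)) (ht : 1 < t) (htc : t * (1 - c) < 1) :
    ∃ κ M : ℝ, 0 < κ ∧ 0 < M ∧ ∀ α₀ N s : ℝ, 0 < α₀ → α₀ ≤ N → 0 < s →
      ∫ α in Ioc α₀ N, testKernel p Q c s (s ^ (1 - p)) α * α ^ (t - 1) ≤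
        M * α₀ ^ (t - 1) * s - κ * (if s ≤ c * N then s ^ t else 0) := by
  have ht0 : 0 < t := by linarith
  have ht1 : 0 < t - 1 := by linarith
  have htp : 0 < t + p - 1 := by linarith
  have hp1 : 0 < p - 1 := by linarith
  set G : ℝ → ℝ := fun y => Q * p / t - Q * (p - 1) * y / (t - 1) - y ^ (1 - p) / (t + p - 1)
    with hG
  have hGc : G c < 0 := by
    have : G c = -(Q * p * (p - 1) * (1 - t * (1 - c)) / (t * (t - 1) * (t + p - 1))) := by
      simp only [hG, hc]; field_simp; ring
    rw [this, neg_lt_zero]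
    have := sub_pos.2 htc
    positivity
  obtain ⟨κ, hκ⟩ : ∃ κ, κ = -G c / c ^ t := ⟨_, rfl⟩
  have hκ0 : 0 < κ := by rw [hκ]; exact div_pos (neg_pos.2 hGc) (by positivity)
  obtain ⟨L, hL⟩ : ∃ L, L = Q * (p - 1) / (t - 1) + c ^ (-p) / (t + p - 1) := ⟨_, rfl⟩
  have hL0 : 0 < L := by rw [hL]; positivity
  refine ⟨κ, L + κ * c ^ (t - 1), hκ0, by positivity, fun α₀ N s hα₀ hN hs => ?_⟩
  have hN0 : 0 < N := hα₀.trans_le hN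
  have hst : s ^ t = s ^ (t - 1) * s := by
    rw [Real.rpow_sub_one hs.ne']; field_simp
  rcases lt_or_ge s (c * α₀) with hlt | hge
  · have h0 : ∫ α in Ioc α₀ N, testKernel p Q c s (s ^ (1 - p)) α * α ^ (t - 1) = 0 := by
      refine setIntegral_eq_zero_of_forall_eq_zero fun α hα => ?_
      have : ¬ c * α ≤ s := not_le.2 (hlt.trans_le (by have := hα.1.le; gcongr))
      simp [testKernel, this]
    have hsN : s ≤ c * N := hlt.le.trans (by gcongr)
    rw [h0, if_pos hsN, hst]
    have h1 : s ^ (t - 1) ≤ c ^ (t - 1) * α₀ ^ (t - 1) := by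
      rw [← Real.mul_rpow hc0.le hα₀.le]
      exact Real.rpow_le_rpow hs.le hlt.le ht1.le
    have h2 := mul_le_mul_of_nonneg_left h1 (mul_pos hκ0 hs).le
    have h3 : 0 ≤ L * α₀ ^ (t - 1) * s := by positivity
    linarith
  · rw [setIntegral_testKernel_mul_rpow hp ht hc0 hα₀ hN hge, kernelPrimitive_eq hs hα₀,
      kernelPrimitive_eq hs (lt_min hN0 (div_pos hs hc0))]
    have hlow : -(α₀ ^ t * (Q * p / t - Q * (p - 1) * (s / α₀) / (t - 1) -
        (s / α₀) ^ (1 - p) / (t + p - 1))) ≤ L * α₀ ^ (t - 1) * s := by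
      have h1 : α₀ ^ t = α₀ ^ (t - 1) * α₀ := by
        rw [Real.rpow_sub_one hα₀.ne']; field_simp
      have hcs : c ≤ s / α₀ := by rwa [le_div_iff₀ hα₀]
      have h2 : (s / α₀) ^ (1 - p) ≤ c ^ (-p) * (s / α₀) := by
        have h3 : (s / α₀) ^ (1 - p) = (s / α₀) ^ (-p) * (s / α₀) := by
          rw [← Real.rpow_add_one (by positivity)]; ring_nf
        rw [h3]
        gcongr ?_ * _
        exact Real.rpow_le_rpow_of_nonpos hc0 hcs (by linarith)
      have h4 : L * α₀ ^ (t - 1) * s = α₀ ^ t * (Q * (p - 1) * (s / α₀) / (t - 1) +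
          c ^ (-p) * (s / α₀) / (t + p - 1)) := by
        rw [hL, h1]; field_simp
      rw [h4, ← mul_neg]
      gcongr
      have h5 : 0 < Q * p / t := by positivity
      have h6 := div_le_div_of_nonneg_right h2 htp.le
      linarith
    have hM : 0 ≤ κ * c ^ (t - 1) * α₀ ^ (t - 1) * s := by positivity
    split_ifs with hsN
    · have hmin : min N (s / c) = s / c := min_eq_right (by rwa [div_le_iff₀' hc0])
      have hsc : s / (s / c) = c := by field_simp
      have h1 : (s / c) ^ t * G c = -(κ * s ^ t) := by
        rw [hκ, Real.div_rpow hs.le hc0.le]; field_simp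
      rw [hmin, hsc]
      change (s / c) ^ t * G c - _ ≤ _
      rw [h1]
      linarith
    · have h1 := kernelPrimitive_nonpos hp hQ hc0 hc1 hc ht htc
        (div_pos hs (lt_min hN0 (div_pos hs hc0)))
      have h2 := mul_nonpos_of_nonneg_of_nonpos
        (Real.rpow_nonneg (lt_min hN0 (div_pos hs hc0)).le t) h1
      linarith

end Primitive

/-- Averaging the kernel inequality over the level `α` gives a reverse Hölder inequality. -/
theorem integrable_rpow_and_integral_le {Ω : Type*} [MeasurableSpace Ω] {ν : Measure Ω}
    [IsFiniteMeasure ν] {p Q c t κ M α₀ : ℝ} {σ u : Ω → ℝ} (ht : 0 ≤ t) (hσm : Measurable σ)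
    (hσ : Integrable σ ν) (hu : Integrable u ν) (hc0 : 0 < c)
    (hσ0 : ∀ᵐ x ∂ν, 0 < σ x) (huσ : ∀ᵐ x ∂ν, u x = σ x ^ (1 - p)) (hα₀ : 0 < α₀) (hκ : 0 < κ)
    (hbound : ∀ N s : ℝ, α₀ ≤ N → 0 < s →
      ∫ α in Ioc α₀ N, testKernel p Q c s (s ^ (1 - p)) α * α ^ (t - 1) ≤
        M * α₀ ^ (t - 1) * s - κ * (if s ≤ c * N then s ^ t else 0))
    (hker : ∀ α, α₀ < α → 0 ≤ ∫ x, testKernel p Q c (σ x) (u x) α ∂ν) :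
    Integrable (fun x => σ x ^ t) ν ∧
      ∫ x, σ x ^ t ∂ν ≤ M / κ * α₀ ^ (t - 1) * ∫ x, σ x ∂ν := by
  have hrpow (r N : ℝ) : Integrable (fun α : ℝ => α ^ r) (volume.restrict (Ioc α₀ N)) :=
    ((continuousOn_id.rpow_const fun x hx => Or.inl (hα₀.trans_le hx.1).ne').integrableOn_Icc
      (a := α₀) (b := N)).mono_set Ioc_subset_Icc_self
  have hφ (N : ℝ) : Integrable (fun z : Ω × ℝ => testKernel p Q c (σ z.1) (u z.1) z.2 *
      z.2 ^ (t - 1)) (ν.prod (volume.restrict (Ioc α₀ N))) := by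
    have h1 := ((((integrable_const (μ := ν) (Q * p)).mul_prod (hrpow (t - 1) N)).sub
      ((hσ.const_mul (Q * (p - 1))).mul_prod (hrpow (t - 2) N))).sub
      (hu.mul_prod (hrpow (t + p - 2) N)))
    have hS : MeasurableSet {z : Ω × ℝ | c * z.2 ≤ σ z.1} :=
      measurableSet_le (measurable_snd.const_mul c) (hσm.comp measurable_fst)
    refine (h1.indicator hS).congr ?_
    have hpos : ∀ᵐ z ∂(ν.prod (volume.restrict (Ioc α₀ N))), z.2 ∈ Ioc α₀ N :=
      Measure.quasiMeasurePreserving_snd.ae (ae_restrict_mem measurableSet_Ioc)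
    filter_upwards [hpos] with z hz
    rw [testKernel_mul_rpow (hα₀.trans hz.1)]
    simp [indicator]
  have hind (N : ℝ) : MeasurableSet {x | σ x ≤ c * N} := measurableSet_le hσm measurable_const
  have hbd (N : ℝ) : IntegrableOn (fun x => σ x ^ t) {x | σ x ≤ c * N} ν := by
    refine Integrable.of_bound (C := (c * N) ^ t)
      (hσm.pow_const t).aestronglyMeasurable ?_
    filter_upwards [ae_restrict_of_ae hσ0, ae_restrict_mem (hind N)] with x hx hxN
    rw [Real.norm_of_nonneg (Real.rpow_nonneg hx.le t)]
    exact Real.rpow_le_rpow hx.le hxN ht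
  have hNbound (N : ℝ) (hN : α₀ ≤ N) :
      ∫ x in {x | σ x ≤ c * N}, σ x ^ t ∂ν ≤ M / κ * α₀ ^ (t - 1) * ∫ x, σ x ∂ν := by
    have h1 : 0 ≤ ∫ x, (∫ α in Ioc α₀ N, testKernel p Q c (σ x) (u x) α * α ^ (t - 1)) ∂ν := by
      rw [integral_integral_swap (hφ N)]
      refine setIntegral_nonneg measurableSet_Ioc fun α hα => ?_
      rw [integral_mul_const]
      exact mul_nonneg (hker α hα.1) (Real.rpow_nonneg (hα₀.trans hα.1).le _)
    have h2 : ∫ x, (∫ α in Ioc α₀ N, testKernel p Q c (σ x) (u x) α * α ^ (t - 1)) ∂ν ≤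
        ∫ x, (M * α₀ ^ (t - 1) * σ x -
          κ * {x | σ x ≤ c * N}.indicator (fun x => σ x ^ t) x) ∂ν := by
      refine integral_mono_ae (hφ N).integral_prod_left
        ((hσ.const_mul _).sub (((integrable_indicator_iff (hind N)).2 (hbd N)).const_mul κ)) ?_
      filter_upwards [hσ0, huσ] with x hx hux
      rw [hux]
      exact hbound N (σ x) hN hx
    rw [integral_sub (hσ.const_mul _) (((integrable_indicator_iff (hind N)).2 (hbd N)).const_mul κ),
      integral_const_mul, integral_const_mul, integral_indicator (hind N)] at h2
    have h3 : M / κ * α₀ ^ (t - 1) * ∫ x, σ x ∂ν = M * α₀ ^ (t - 1) * (∫ x, σ x ∂ν) / κ := by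
      ring
    rw [h3, le_div_iff₀ hκ]
    linarith
  have hcover : AECover ν atTop fun N : ℝ => {x | σ x ≤ c * N} := by
    refine ⟨Eventually.of_forall fun x => ?_, hind⟩
    filter_upwards [eventually_ge_atTop (σ x / c)] with N hN
    rwa [div_le_iff₀' hc0] at hN
  have hfint : Integrable (fun x => σ x ^ t) ν := by
    refine hcover.integrable_of_integral_bounded_of_nonneg_ae _ hbd ?_
      ((eventually_ge_atTop α₀).mono hNbound)
    filter_upwards [hσ0] with x hx using Real.rpow_nonneg hx.le t
  exact ⟨hfint, le_of_tendsto (hcover.integral_tendsto_of_countably_generated hfint)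
    ((eventually_ge_atTop α₀).mono hNbound)⟩

/-- Jensen's inequality for the concave function `s ↦ s ^ t`. -/
theorem integrable_rpow_and_average_rpow_le {Ω : Type*} [MeasurableSpace Ω] {ν : Measure Ω}
    [IsFiniteMeasure ν] {t : ℝ} {σ : Ω → ℝ} (ht0 : 0 ≤ t) (ht1 : t ≤ 1)
    (hσm : Measurable σ) (hσ : Integrable σ ν) (hσ0 : ∀ᵐ x ∂ν, 0 < σ x) (hν : ν ≠ 0)
    (hpos : 0 < ⨍ x, σ x ∂ν) :
    Integrable (fun x => σ x ^ t) ν ∧ ⨍ x, σ x ^ t ∂ν ≤ (⨍ x, σ x ∂ν) ^ t := by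
  set m := ⨍ x, σ x ∂ν with hm
  have hle : ∀ᵐ x ∂ν, σ x ^ t ≤ m ^ t * (1 + t * (σ x / m - 1)) := by
    filter_upwards [hσ0] with x hx
    have h1 := rpow_one_add_le_one_add_mul_self (s := σ x / m - 1)
      (by linarith [div_pos hx hpos]) ht0 ht1
    rw [add_sub_cancel, Real.div_rpow hx.le hpos.le, div_le_iff₀ (by positivity)] at h1
    linarith
  have hfint : Integrable (fun x => m ^ t * (1 + t * (σ x / m - 1))) ν :=
    ((integrable_const _).add (((hσ.div_const m).sub (integrable_const _)).const_mul t)).const_mul _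
  have hfint' : Integrable (fun x => σ x ^ t) ν := by
    refine hfint.mono' (hσm.pow_const t).aestronglyMeasurable ?_
    filter_upwards [hσ0, hle] with x hx hxle
    rwa [Real.norm_of_nonneg (Real.rpow_nonneg hx.le t)]
  refine ⟨hfint', ?_⟩
  have hνpos : 0 < ν.real univ := by
    rw [measureReal_def]
    exact ENNReal.toReal_pos (by simpa using hν) (measure_ne_top _ _)
  have h2 := integral_mono_ae hfint' hfint hle
  have hmi : ∫ x, σ x ∂ν = ν.real univ * m := by
    rw [hm, average_eq, smul_eq_mul, mul_inv_cancel_left₀ hνpos.ne']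
  have hdev : Integrable (fun x => σ x / m - 1) ν := (hσ.div_const m).sub (integrable_const _)
  rw [integral_const_mul, integral_add (integrable_const _) (hdev.const_mul t), integral_const_mul,
    integral_sub (hσ.div_const m) (integrable_const _), integral_div, hmi] at h2
  simp only [integral_const, smul_eq_mul, mul_one, mul_div_cancel_right₀ _ hpos.ne', sub_self,
    mul_zero, add_zero] at h2
  rw [average_eq, smul_eq_mul, inv_mul_le_iff₀ hνpos]
  linarith

theorem isBox_iff_openBox {n : ℕ} {R : Set (Fin n → ℝ)} :
    IsBox R ↔ ∃ a b : Fin n → ℝ, (∀ i, a i < b i) ∧ R = openBox a b :=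
  Iff.rfl

section Weight

variable {n : ℕ} {μ : Measure (Fin n → ℝ)} {w : (Fin n → ℝ) → ℝ} {p Q c : ℝ}

theorem setIntegral_eq_measureReal_mul_boxAvg {R : Set (Fin n → ℝ)} (h0 : 0 < μ R)
    (hfin : μ R < ⊤) (f : (Fin n → ℝ) → ℝ) :
    ∫ x in R, f x ∂μ = μ.real R * boxAvg μ R f := by
  rw [boxAvg, setAverage_eq, smul_eq_mul, mul_inv_cancel_left₀]
  exact (ENNReal.toReal_pos h0.ne' hfin.ne).ne'

theorem ApBound.on_openBox [IsLocallyFiniteMeasure μ] (h : ApBound μ w p Q) {a b : Fin n → ℝ}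
    (hpos : 0 < μ (openBox a b)) :
    IntegrableOn w (openBox a b) μ ∧
      IntegrableOn (fun x => w x ^ (-1 / (p - 1))) (openBox a b) μ ∧
      boxAvg μ (openBox a b) w *
        (boxAvg μ (openBox a b) fun x => w x ^ (-1 / (p - 1))) ^ (p - 1) ≤ Q := by
  refine h _ (isBox_iff_openBox.2 ⟨a, b, fun i => ?_, rfl⟩) hpos measure_openBox_lt_top
  obtain ⟨x, hx⟩ := nonempty_of_measure_ne_zero hpos.ne'
  exact ((mem_openBox.1 hx) i).1.trans ((mem_openBox.1 hx) i).2

theorem ApBound.integrableOn_openBox [IsLocallyFiniteMeasure μ] (h : ApBound μ w p Q)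
    (a b : Fin n → ℝ) :
    IntegrableOn w (openBox a b) μ ∧
      IntegrableOn (fun x => w x ^ (-1 / (p - 1))) (openBox a b) μ := by
  rcases eq_or_ne (μ (openBox a b)) 0 with h0 | h0
  · simp [IntegrableOn, Measure.restrict_eq_zero.2 h0]
  · exact ⟨(h.on_openBox (pos_iff_ne_zero.2 h0)).1, (h.on_openBox (pos_iff_ne_zero.2 h0)).2.1⟩

theorem ae_eq_rpow_one_sub (hp : 1 < p) (hw0 : ∀ᵐ x ∂μ, 0 < w x) :
    ∀ᵐ x ∂μ, w x = (w x ^ (-1 / (p - 1))) ^ (1 - p) := by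
  filter_upwards [hw0] with x hx
  have : p - 1 ≠ 0 := by linarith
  rw [← Real.rpow_mul hx.le, show -1 / (p - 1) * (1 - p) = 1 by field_simp; ring, Real.rpow_one]

theorem ApBound.setIntegral_testKernel_nonneg [IsLocallyFiniteMeasure μ] (h : ApBound μ w p Q)
    (hμ : NullHyperplanes μ) (hwm : Measurable w) (hw0 : ∀ᵐ x ∂μ, 0 < w x)
    (hp : 1 < p) (hQ : 1 < Q) (hc0 : 0 < c) (hc1 : c < 1)
    (hc : c ^ (1 - p) = Q * (p - (p - 1) * c)) {α : ℝ} (hα : 0 < α) (a b : Fin n → ℝ)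
    (hab : ∫ x in openBox a b, w x ^ (-1 / (p - 1)) ∂μ ≤ α * μ.real (openBox a b)) :
    0 ≤ ∫ x in openBox a b, testKernel p Q c (w x ^ (-1 / (p - 1))) (w x) α ∂μ := by
  have hfin (a b : Fin n → ℝ) : IsFiniteMeasure (μ.restrict (openBox a b)) :=
    ⟨by simpa using measure_openBox_lt_top⟩
  set σ : (Fin n → ℝ) → ℝ := fun x => w x ^ (-1 / (p - 1)) with hσdef
  have hσm : Measurable σ := hwm.pow_const _
  have hwi (a b : Fin n → ℝ) : IntegrableOn w (openBox a b) μ := (h.integrableOn_openBox a b).1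
  have hσi (a b : Fin n → ℝ) : IntegrableOn σ (openBox a b) μ := (h.integrableOn_openBox a b).2
  have hσ0 : ∀ᵐ x ∂μ, 0 < σ x := hw0.mono fun x hx => Real.rpow_pos_of_pos hx _
  have hwσ : ∀ᵐ x ∂μ, w x = σ x ^ (1 - p) := ae_eq_rpow_one_sub hp hw0
  have hfint (a b : Fin n → ℝ) (f : (Fin n → ℝ) → ℝ) (hf : IntegrableOn f (openBox a b) μ) :
      ∫ x in openBox a b, (f x - α) ∂μ =
        ∫ x in openBox a b, f x ∂μ - α * μ.real (openBox a b) := by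
    rw [integral_sub hf (integrable_const _)]
    simp [mul_comm]
  have hlin (a b : Fin n → ℝ) : IntegrableOn
      (fun x => Q * (p - (p - 1) * (σ x / α)) - w x * α ^ (p - 1)) (openBox a b) μ :=
    (((integrable_const _).sub (((hσi a b).div_const α).const_mul _)).const_mul Q).sub
      ((hwi a b).mul_const _)
  have hK (a b : Fin n → ℝ) :
      IntegrableOn (fun x => testKernel p Q c (σ x) (w x) α) (openBox a b) μ :=
    (hlin a b).indicator (measurableSet_le measurable_const hσm : MeasurableSet {x | c * α ≤ σ x})
  refine setIntegral_openBox_nonneg hμ (f := fun x => σ x - α)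
    (fun a b => (hσi a b).sub (integrable_const _)) hK (fun a b hz => ?_)
    (C := Q * (p - 1) / α) ?_ ?_ a b ?_
  · rcases eq_or_ne (μ (openBox a b)) 0 with h0 | h0
    · simp [Measure.restrict_eq_zero.2 h0]
    replace h0 := pos_iff_ne_zero.2 h0
    have hm : 0 < μ.real (openBox a b) := ENNReal.toReal_pos h0.ne' measure_openBox_lt_top.ne
    rw [hfint a b σ (hσi a b),
      setIntegral_eq_measureReal_mul_boxAvg h0 measure_openBox_lt_top] at hz
    have hσα : boxAvg μ (openBox a b) σ = α := by
      refine mul_left_cancel₀ hm.ne' ?_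
      linarith
    have hA := (h.on_openBox h0).2.2
    change _ * boxAvg μ (openBox a b) σ ^ (p - 1) ≤ Q at hA
    rw [hσα] at hA
    have hmono : ∫ x in openBox a b, (Q * (p - (p - 1) * (σ x / α)) - w x * α ^ (p - 1)) ∂μ ≤
        ∫ x in openBox a b, testKernel p Q c (σ x) (w x) α ∂μ := by
      refine integral_mono_ae (hlin a b) (hK a b) (ae_restrict_of_ae ?_)
      filter_upwards [hσ0, hwσ] with x hx hwx
      rw [hwx]
      exact le_testKernel hp hQ hc0 hc1 hc hx hα
    refine ((mul_nonneg hm.le (sub_nonneg.2 hA)).trans_eq ?_).trans hmono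
    have hσlin : IntegrableOn (fun x => p - (p - 1) * (σ x / α)) (openBox a b) μ :=
      (integrable_const _).sub (((hσi a b).div_const α).const_mul _)
    rw [integral_sub (hσlin.const_mul Q) ((hwi a b).mul_const _), integral_const_mul,
      integral_sub (integrable_const _) (((hσi a b).div_const α).const_mul _), integral_const_mul,
      integral_div, integral_mul_const,
      setIntegral_eq_measureReal_mul_boxAvg h0 measure_openBox_lt_top w,
      setIntegral_eq_measureReal_mul_boxAvg h0 measure_openBox_lt_top σ, hσα]
    simp only [integral_const, smul_eq_mul, measureReal_restrict_apply_univ]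
    field_simp
    ring
  · have := sub_pos.2 hp
    positivity
  · filter_upwards [hσ0, hwσ] with x hx hwx
    rw [hwx]
    exact neg_mul_max_le_testKernel hp hQ hc0 hc hx hα
  · rw [hfint a b σ (hσi a b)]
    linarith

/-- Uniform reverse Hölder inequality for the dual weight. -/
theorem exists_boxAvg_rpow_le {t : ℝ} (hp : 1 < p) (hQ : 1 < Q) (hc0 : 0 < c) (hc1 : c < 1)
    (hc : c ^ (1 - p) = Q * (p - (p - 1) * c)) (ht0 : 0 < t) (htc : t * (1 - c) < 1) :
    ∃ D : ℝ, 0 < D ∧ ∀ n : ℕ, ∀ μ : Measure (Fin n → ℝ), IsLocallyFiniteMeasure μ →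
      NullHyperplanes μ → ∀ w : (Fin n → ℝ) → ℝ, Measurable w → (∀ᵐ x ∂μ, 0 < w x) →
      ApBound μ w p Q → ∀ a b : Fin n → ℝ, 0 < μ (openBox a b) →
      IntegrableOn (fun x => (w x ^ (-1 / (p - 1))) ^ t) (openBox a b) μ ∧
      boxAvg μ (openBox a b) (fun x => (w x ^ (-1 / (p - 1))) ^ t) ≤
        D * boxAvg μ (openBox a b) (fun x => w x ^ (-1 / (p - 1))) ^ t := by
  obtain ⟨D, hD, H⟩ : ∃ D : ℝ, 0 < D ∧ ∀ n : ℕ, ∀ μ : Measure (Fin n → ℝ),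
      IsLocallyFiniteMeasure μ →
      NullHyperplanes μ → ∀ w : (Fin n → ℝ) → ℝ, Measurable w → (∀ᵐ x ∂μ, 0 < w x) →
      ApBound μ w p Q → ∀ a b : Fin n → ℝ, 0 < μ (openBox a b) →
      0 < boxAvg μ (openBox a b) (fun x => w x ^ (-1 / (p - 1))) →
      IntegrableOn (fun x => (w x ^ (-1 / (p - 1))) ^ t) (openBox a b) μ ∧
      boxAvg μ (openBox a b) (fun x => (w x ^ (-1 / (p - 1))) ^ t) ≤
        D * boxAvg μ (openBox a b) (fun x => w x ^ (-1 / (p - 1))) ^ t := by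
    rcases le_or_gt t 1 with ht | ht
    · refine ⟨1, one_pos, fun n μ hloc hμ w hwm hw0 h a b h0 hpos => ?_⟩
      have : IsFiniteMeasure (μ.restrict (openBox a b)) :=
        ⟨by simpa using measure_openBox_lt_top⟩
      rw [one_mul]
      exact integrable_rpow_and_average_rpow_le ht0.le ht (hwm.pow_const _)
        (h.integrableOn_openBox a b).2
        (ae_restrict_of_ae (hw0.mono fun x hx => Real.rpow_pos_of_pos hx _))
        (by simpa [Measure.restrict_eq_zero] using h0.ne') hpos
    · obtain ⟨κ, M, hκ, hM, hbound⟩ :=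
        exists_setIntegral_testKernel_le hp hQ hc0 hc1 hc ht htc
      refine ⟨M / κ, by positivity, fun n μ hloc hμ w hwm hw0 h a b h0 hpos => ?_⟩
      have : IsFiniteMeasure (μ.restrict (openBox a b)) :=
        ⟨by simpa using measure_openBox_lt_top⟩
      have hm : 0 < μ.real (openBox a b) := ENNReal.toReal_pos h0.ne' measure_openBox_lt_top.ne
      have key := integrable_rpow_and_integral_le ht0.le (hwm.pow_const (-1 / (p - 1)))
        (h.integrableOn_openBox a b).2 (h.integrableOn_openBox a b).1 hc0
        (ae_restrict_of_ae (hw0.mono fun x hx => Real.rpow_pos_of_pos hx _))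
        (ae_restrict_of_ae (ae_eq_rpow_one_sub hp hw0)) hpos hκ
        (fun N s hN hs => hbound _ N s hpos hN hs) (fun α hα => ?_)
      · refine ⟨key.1, ?_⟩
        have h2 := key.2
        rw [setIntegral_eq_measureReal_mul_boxAvg h0 measure_openBox_lt_top,
          setIntegral_eq_measureReal_mul_boxAvg h0 measure_openBox_lt_top,
          Real.rpow_sub_one hpos.ne'] at h2
        refine le_of_mul_le_mul_left (h2.trans_eq ?_) hm
        generalize (boxAvg μ (openBox a b) fun x => w x ^ (-1 / (p - 1))) = m at hpos
        field_simp
      · refine h.setIntegral_testKernel_nonneg hμ hwm hw0 hp hQ hc0 hc1 hc (hpos.trans hα) a b ?_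
        rw [setIntegral_eq_measureReal_mul_boxAvg h0 measure_openBox_lt_top, mul_comm]
        gcongr
  refine ⟨D, hD, fun n μ hloc hμ w hwm hw0 h a b h0 => H n μ hloc hμ w hwm hw0 h a b h0 ?_⟩
  have hm : 0 < μ.real (openBox a b) := ENNReal.toReal_pos h0.ne' measure_openBox_lt_top.ne
  have hσ0 : ∀ᵐ x ∂μ.restrict (openBox a b), 0 < w x ^ (-1 / (p - 1)) :=
    ae_restrict_of_ae (hw0.mono fun x hx => Real.rpow_pos_of_pos hx _)
  have hI : 0 < ∫ x in openBox a b, w x ^ (-1 / (p - 1)) ∂μ := by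
    rw [integral_pos_iff_support_of_nonneg_ae (hσ0.mono fun x hx => hx.le)
      (h.integrableOn_openBox a b).2]
    have : Function.support (fun x => w x ^ (-1 / (p - 1))) =ᵐ[μ.restrict (openBox a b)] univ := by
      filter_upwards [hσ0] with x hx
      exact propext (iff_of_true hx.ne' trivial)
    rw [measure_congr this]
    simpa using h0
  rw [setIntegral_eq_measureReal_mul_boxAvg h0 measure_openBox_lt_top] at hI
  exact pos_of_mul_pos_right hI hm.le

end Weight

/-- Self-improvement `A_p^* ⊂ A_q^*` for `q > 1 - s⁻_{p1}(Q)`, with a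
constant independent of the dimension and of the measure. -/
theorem strong_Ap_self_improvement_to_Aq
    (p Q p1 : ℝ) (hp : 1 < p) (hQ : 1 < Q) (hp1 : p1 = -1 / (p - 1))
    (sm : ℝ) (hsm_mem : sm ∈ Icc (1 / p1) 0)
    (hsm : (1 - sm) * (1 - p1 * sm) ^ (-1 / p1) = 1 / Q)
    (q : ℝ) (hq : 1 - sm < q) :
    ∃ C : ℝ, 0 < C ∧
      ∀ n : ℕ, 1 ≤ n →
        ∀ μ : Measure (Fin n → ℝ), IsLocallyFiniteMeasure μ → NullHyperplanes μ →
          ∀ w : (Fin n → ℝ) → ℝ, Measurable w → (∀ᵐ x ∂μ, 0 < w x) →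
            ApBound μ w p Q → ApBound μ w q C := by
  have hp' : 0 < p - 1 := sub_pos.2 hp
  subst hp1
  have hexp : -1 / (-1 / (p - 1)) = p - 1 := by field_simp
  have hinv : 1 / (-1 / (p - 1)) = -(p - 1) := by field_simp
  rw [hexp] at hsm
  rw [hinv] at hsm_mem
  obtain ⟨c, hcdef⟩ : ∃ c, c = 1 - -1 / (p - 1) * sm := ⟨_, rfl⟩
  rw [← hcdef] at hsm
  have hsm_eq : 1 - sm = p - (p - 1) * c := by rw [hcdef]; field_simp; ring
  have hc_nonneg : 0 ≤ c := by
    have h1 : (p - 1) * c = p - 1 + sm := by linarith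
    have h2 : 0 ≤ (p - 1) * c := by linarith [hsm_mem.1]
    exact nonneg_of_mul_nonneg_right h2 hp'
  have hQ0 : 0 < 1 / Q := by positivity
  have hc0 : 0 < c := by
    refine lt_of_le_of_ne hc_nonneg fun h0 => ?_
    rw [← h0, Real.zero_rpow hp'.ne', mul_zero] at hsm
    linarith
  have hc1 : c < 1 := by
    by_contra! h1
    have h2 : sm = 0 := by nlinarith [hsm_mem.2]
    have h3 : c = 1 := by rw [hcdef, h2]; ring
    rw [h2, h3, Real.one_rpow, eq_div_iff (by positivity)] at hsm
    linarith
  have hc : c ^ (1 - p) = Q * (p - (p - 1) * c) := by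
    rw [← hsm_eq, ← neg_sub, Real.rpow_neg hc0.le]
    rw [eq_div_iff (by positivity)] at hsm
    refine inv_eq_of_mul_eq_one_left ?_
    linarith
  have hq1 : 0 < q - 1 := by nlinarith
  obtain ⟨t, ht⟩ : ∃ t, t = (p - 1) / (q - 1) := ⟨_, rfl⟩
  have ht0 : 0 < t := by rw [ht]; positivity
  have htc : t * (1 - c) < 1 := by
    rw [ht, div_mul_eq_mul_div, div_lt_one hq1]
    linarith
  obtain ⟨D, hD, H⟩ := exists_boxAvg_rpow_le hp hQ hc0 hc1 hc ht0 htc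
  refine ⟨Q * D ^ (q - 1), by positivity, fun n _ μ hloc hμ w hwm hw0 h R hR h0 hfin => ?_⟩
  obtain ⟨a, b, -, rfl⟩ := isBox_iff_openBox.1 hR
  obtain ⟨hfint, hle⟩ := H n μ hloc hμ w hwm hw0 h a b h0
  obtain ⟨hwi, -, hA⟩ := h.on_openBox h0
  have hpow : ∀ᵐ x ∂μ.restrict (openBox a b),
      (w x ^ (-1 / (p - 1))) ^ t = w x ^ (-1 / (q - 1)) := by
    filter_upwards [ae_restrict_of_ae hw0] with x hx
    rw [← Real.rpow_mul hx.le, ht]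
    congr 1
    field_simp
  have hnonneg (r : ℝ) : 0 ≤ boxAvg μ (openBox a b) fun x => w x ^ r := by
    rw [boxAvg, setAverage_eq]
    refine smul_nonneg (by positivity) (integral_nonneg_of_ae ?_)
    filter_upwards [ae_restrict_of_ae hw0] with x hx using Real.rpow_nonneg hx.le r
  have hwnonneg : 0 ≤ boxAvg μ (openBox a b) w := by simpa using hnonneg 1
  have havg : (boxAvg μ (openBox a b) fun x => (w x ^ (-1 / (p - 1))) ^ t) =
      boxAvg μ (openBox a b) fun x => w x ^ (-1 / (q - 1)) := by
    simp only [boxAvg, average_eq, integral_congr_ae hpow]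
  refine ⟨hwi, hfint.congr hpow, ?_⟩
  rw [havg] at hle
  have hs := hnonneg (-1 / (p - 1))
  calc boxAvg μ (openBox a b) w * (boxAvg μ (openBox a b) fun x => w x ^ (-1 / (q - 1))) ^ (q - 1)
      ≤ boxAvg μ (openBox a b) w *
        (D * (boxAvg μ (openBox a b) fun x => w x ^ (-1 / (p - 1))) ^ t) ^ (q - 1) := by
        gcongr
        exact hnonneg _
    _ = (boxAvg μ (openBox a b) w *
        (boxAvg μ (openBox a b) fun x => w x ^ (-1 / (p - 1))) ^ (p - 1)) * D ^ (q - 1) := by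
        rw [Real.mul_rpow hD.le (Real.rpow_nonneg hs t), ← Real.rpow_mul hs, ht,
          div_mul_cancel₀ _ hq1.ne']
        ring
    _ ≤ Q * D ^ (q - 1) := by gcongr
end
end

section
/- Let p>1, Q>1, p1 = -1/(p-1), and let q₀ = 1 - s⁻_{p1}(Q). Then on the real line with Lebesgue measure the range q > q₀ in the inclusion A_p ⊂ A_q is sharp: there exists a weight w on ℝ with [w]_p = Q and [w]_{q₀} = ∞, i.e. w ∉ A_{q₀}. -/
open MeasureTheory Set Filter

noncomputable section

/-- Average of `f` over the interval `(a,b)` with respect to Lebesgue measure. -/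
def intAvg (a b : ℝ) (f : ℝ → ℝ) : ℝ := ⨍ x in Ioo a b, f x

/-- The `A_p` characteristic quantity `⟨w⟩_I ⟨w^{-1/(p-1)}⟩_I^{p-1}` of `w` on `I = (a,b)`. -/
def ApChar (w : ℝ → ℝ) (p a b : ℝ) : ℝ :=
  intAvg a b w * (intAvg a b fun x => w x ^ (-1 / (p - 1))) ^ (p - 1)

/-- The `RH_p` characteristic quantity `⟨w^p⟩_I^{1/p} ⟨w⟩_I^{-1}` of `w` on `I = (a,b)`. -/
def RHChar (w : ℝ → ℝ) (p a b : ℝ) : ℝ :=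
  (intAvg a b fun x => w x ^ p) ^ (1 / p) * (intAvg a b w)⁻¹

/-- `[w]_p ≤ C` on the real line (with the requisite integrability on every interval). -/
def MemAp (w : ℝ → ℝ) (p C : ℝ) : Prop :=
  ∀ a b : ℝ, a < b →
    IntegrableOn w (Ioo a b) ∧ IntegrableOn (fun x => w x ^ (-1 / (p - 1))) (Ioo a b) ∧
    ApChar w p a b ≤ C

/-- `[w]_{RH_p} ≤ C` on the real line (with the requisite integrability on every interval). -/
def MemRH (w : ℝ → ℝ) (p C : ℝ) : Prop :=
  ∀ a b : ℝ, a < b →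
    IntegrableOn w (Ioo a b) ∧ IntegrableOn (fun x => w x ^ p) (Ioo a b) ∧
    RHChar w p a b ≤ C

theorem intAvg_eq_intervalIntegral {a b : ℝ} (hab : a < b) (f : ℝ → ℝ) :
    intAvg a b f = (b - a)⁻¹ * ∫ x in a..b, f x := by
  rw [intAvg, setAverage_eq, intervalIntegral.integral_of_le hab.le, integral_Ioc_eq_integral_Ioo]
  simp [Measure.real, Real.volume_Ioo, hab.le]

/-- A measurable weight with values in a compact subset of `(0, ∞)`. -/
structure BddWeight (g : ℝ → ℝ) : Prop where
  measurable : Measurable g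
  bounds : ∃ lo hi : ℝ, 0 < lo ∧ ∀ x, lo ≤ g x ∧ g x ≤ hi

theorem BddWeight.pos {g : ℝ → ℝ} (hg : BddWeight g) (x : ℝ) : 0 < g x := by
  obtain ⟨lo, hi, h0, h⟩ := hg.bounds
  exact h0.trans_le (h x).1

theorem BddWeight.const_mul {g : ℝ → ℝ} (hg : BddWeight g) {c : ℝ} (hc : 0 < c) :
    BddWeight (fun x => c * g x) := by
  obtain ⟨lo, hi, h0, h⟩ := hg.bounds
  refine ⟨hg.measurable.const_mul c, c * lo, c * hi, by positivity, fun x => ?_⟩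
  exact ⟨by gcongr; exact (h x).1, by gcongr; exact (h x).2⟩

theorem BddWeight.exists_abs_comp_le {g h : ℝ → ℝ} (hg : BddWeight g)
    (hc : ContinuousOn h (Ioi 0)) : ∃ C, 0 ≤ C ∧ ∀ x, |h (g x)| ≤ C := by
  obtain ⟨lo, hi, h0, hb⟩ := hg.bounds
  have hsub : Icc lo hi ⊆ Ioi 0 := fun x hx => h0.trans_le hx.1
  obtain ⟨C, hC⟩ := isCompact_Icc.exists_bound_of_continuousOn (hc.mono hsub)
  exact ⟨C, (abs_nonneg _).trans (hC (g 0) (hb 0)), fun x => hC (g x) (hb x)⟩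

theorem BddWeight.intervalIntegrable_comp {g h : ℝ → ℝ} (hg : BddWeight g) (hm : Measurable h)
    (hc : ContinuousOn h (Ioi 0)) (a b : ℝ) :
    IntervalIntegrable (fun x => h (g x)) volume a b := by
  obtain ⟨C, -, hC⟩ := hg.exists_abs_comp_le hc
  exact (intervalIntegrable_const (c := C)).mono_fun
    (hm.comp hg.measurable).aestronglyMeasurable
    (Eventually.of_forall fun x => (hC x).trans (le_abs_self C))

theorem integral_periodic_le {f : ℝ → ℝ} (hf : Function.Periodic f 1)
    (hi : ∀ a b, IntervalIntegrable f volume a b) (h1 : ∫ x in (0 : ℝ)..1, f x ≤ 0) {M : ℝ}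
    (hM : ∀ s ∈ Icc (0 : ℝ) 1, ∫ x in (0 : ℝ)..s, f x ≤ M) {t : ℝ} (ht : 0 ≤ t) :
    ∫ x in (0 : ℝ)..t, f x ≤ M := by
  have key : ∀ n : ℕ, ∀ s ∈ Icc (0 : ℝ) 1, ∫ x in (0 : ℝ)..(n + s), f x ≤ M := by
    intro n
    induction n with
    | zero => intro s hs; simpa using hM s hs
    | succ n ih =>
      intro s hs
      have h2 : ∫ x in (1 : ℝ)..((n + 1 : ℕ) + s), f x = ∫ x in (0 : ℝ)..(n + s), f x := by
        have := intervalIntegral.integral_comp_add_right (a := 0) (b := n + s) f 1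
        simp only [hf _] at this
        rw [this]
        congr 1 <;> push_cast <;> ring
      rw [← intervalIntegral.integral_add_adjacent_intervals (hi 0 1) (hi 1 _), h2]
      linarith [ih s hs]
  have := key ⌊t⌋₊ (t - ⌊t⌋₊)
    ⟨by linarith [Nat.floor_le ht], by linarith [Nat.lt_floor_add_one t]⟩
  simpa using this

theorem integral_periodic_nat {f : ℝ → ℝ} (hf : Function.Periodic f 1)
    (hi : ∀ a b, IntervalIntegrable f volume a b) (n : ℕ) :
    ∫ x in (0 : ℝ)..n, f x = n * ∫ x in (0 : ℝ)..1, f x := by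
  have := hf.intervalIntegral_add_zsmul_eq n 0 hi
  simpa using this

theorem integral_periodic_even_le_zero {f : ℝ → ℝ} (hf : Function.Periodic f 1)
    (he : ∀ x, f (-x) = f x) (hi : ∀ a b, IntervalIntegrable f volume a b)
    (h : ∀ t, 0 ≤ t → ∫ x in (0 : ℝ)..t, f x ≤ 0) {x y : ℝ} {m : ℤ} (hx : x ≤ m) (hy : (m : ℝ) ≤ y) :
    ∫ z in x..y, f z ≤ 0 := by
  have hm : ∀ z, f (z + m) = f z := fun z => by simpa using hf.int_mul m z
  rw [← intervalIntegral.integral_add_adjacent_intervals (hi x m) (hi m y)]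
  have h1 := intervalIntegral.integral_comp_add_right (a := 0) (b := y - m) f m
  have h2 := intervalIntegral.integral_comp_add_right (a := x - m) (b := 0) f m
  have h3 := intervalIntegral.integral_comp_neg (a := 0) (b := m - x) f
  simp only [hm, he, sub_add_cancel, zero_add, neg_zero, neg_sub] at h1 h2 h3
  rw [← h1, ← h2, ← h3]
  linarith [h (y - m) (by linarith), h (m - x) (by linarith)]

/-- A `1`-periodic even weight whose averages are controlled by the functional `φ`: uniformly for
intervals starting at an integer, and after rescaling for all other intervals. -/
structure AdmissibleCell (φ : ℝ → ℝ) (r : ℝ) (g : ℝ → ℝ) : Prop extends BddWeight g where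
  periodic : Function.Periodic g 1
  even : ∀ x, g (-x) = g x
  anchored : ∀ t, 0 ≤ t → ∫ x in (0 : ℝ)..t, φ (r * g x) ≤ 0
  rescaled : ∀ x y, x < y → ∃ σ, 0 < σ ∧ ∫ z in x..y, φ (σ * g z) ≤ 0

theorem AdmissibleCell.integral_le_zero_of_int_mem {φ : ℝ → ℝ} {r : ℝ} {g : ℝ → ℝ} (hr : 0 < r)
    (hm : Measurable φ) (hc : ContinuousOn φ (Ioi 0)) (hg : AdmissibleCell φ r g) {x y : ℝ} {m : ℤ}
    (hx : x ≤ m) (hy : (m : ℝ) ≤ y) : ∫ z in x..y, φ (r * g z) ≤ 0 :=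
  integral_periodic_even_le_zero (f := fun z => φ (r * g z))
    (fun z => by simp [hg.periodic z]) (fun z => by simp [hg.even z])
    ((hg.toBddWeight.const_mul hr).intervalIntegrable_comp hm hc) hg.anchored hx hy

/-- In every unit cell, the value is `1` at distance `≤ θ / 2` from the ends, and the rest of the
cell is filled by `N` periods of `ρ * g`. -/
def refineCell (θ ρ : ℝ) (N : ℕ) (g : ℝ → ℝ) (x : ℝ) : ℝ :=
  if Int.fract x ≤ θ / 2 ∨ 1 - θ / 2 ≤ Int.fract x then 1
  else ρ * g (N * (Int.fract x - θ / 2) / (1 - θ))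

section refine

variable {θ ρ : ℝ} {N : ℕ} {g : ℝ → ℝ}

theorem refineCell_periodic : Function.Periodic (refineCell θ ρ N g) 1 := by
  intro x
  simp [refineCell]

theorem refineCell_even (hθ : θ < 1) (hp : Function.Periodic g 1)
    (he : ∀ x, g (-x) = g x) (x : ℝ) : refineCell θ ρ N g (-x) = refineCell θ ρ N g x := by
  unfold refineCell
  by_cases hx : Int.fract x = 0
  · rw [Int.fract_neg_eq_zero.2 hx, hx]
  · rw [Int.fract_neg hx]
    have h1 : (1 - Int.fract x ≤ θ / 2 ∨ 1 - θ / 2 ≤ 1 - Int.fract x) ↔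
        (Int.fract x ≤ θ / 2 ∨ 1 - θ / 2 ≤ Int.fract x) := by
      constructor <;> rintro (h | h)
      · right; linarith
      · left; linarith
      · right; linarith
      · left; linarith
    simp only [h1]
    congr 2
    have h2 : (N : ℝ) * (1 - Int.fract x - θ / 2) / (1 - θ) =
        -(N * (Int.fract x - θ / 2) / (1 - θ)) + N := by
      have : 1 - θ ≠ 0 := by linarith
      field_simp
      ring
    have h3 := hp.nat_mul N (-(N * (Int.fract x - θ / 2) / (1 - θ)))
    rw [mul_one] at h3
    rw [h2, h3, he]

theorem refineCell_bddWeight (hρ : 0 < ρ) (hg : BddWeight g) : BddWeight (refineCell θ ρ N g) := by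
  obtain ⟨lo, hi, h0, hb⟩ := (hg.const_mul hρ).bounds
  refine ⟨?_, min 1 lo, max 1 hi, by positivity, fun x => ?_⟩
  · refine Measurable.ite ?_ measurable_const ?_
    · exact (measurableSet_le measurable_fract measurable_const).union
        (measurableSet_le measurable_const measurable_fract)
    · refine (hg.measurable.comp ?_).const_mul ρ
      exact ((measurable_fract.sub_const _).const_mul _).div_const _
  · unfold refineCell
    split_ifs
    · simp
    · exact ⟨(min_le_right _ _).trans (hb _).1, (hb _).2.trans (le_max_right _ _)⟩

theorem refineCell_integral_left (h : ℝ → ℝ) (hθ : θ < 1) {u v : ℝ} (hu : 0 ≤ u) (huv : u ≤ v)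
    (hv : v ≤ θ / 2) : ∫ x in u..v, h (refineCell θ ρ N g x) = (v - u) * h 1 := by
  rw [intervalIntegral.integral_congr (g := fun _ => h 1)]
  · simp
  · intro x hx
    rw [uIcc_of_le huv] at hx
    have : Int.fract x = x := Int.fract_eq_self.2 ⟨by linarith [hx.1], by linarith [hx.2]⟩
    have h3 : x ≤ θ / 2 := by linarith [hx.2]
    simp [refineCell, this, h3]

theorem refineCell_integral_right (h : ℝ → ℝ) (hθ : θ < 1) {u v : ℝ} (hu : 1 - θ / 2 ≤ u)
    (huv : u ≤ v) (hv : v ≤ 1) :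
    ∫ x in u..v, h (refineCell θ ρ N g x) = (v - u) * h 1 := by
  rw [intervalIntegral.integral_of_le huv, integral_Ioc_eq_integral_Ioo,
    setIntegral_congr_fun measurableSet_Ioo (g := fun _ => h 1)]
  · simp [huv]
  · intro x hx
    have : Int.fract x = x := Int.fract_eq_self.2 ⟨by linarith [hx.1], by linarith [hx.2]⟩
    have h3 : 1 - θ / 2 ≤ x := by linarith [hx.1]
    simp [refineCell, this, h3]

theorem refineCell_integral_mid (h : ℝ → ℝ) (hθ0 : 0 < θ) (hθ : θ < 1) (hN : 0 < N) {u v : ℝ}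
    (hu : θ / 2 ≤ u) (huv : u ≤ v) (hv : v ≤ 1 - θ / 2) :
    ∫ x in u..v, h (refineCell θ ρ N g x) = (1 - θ) / N *
      ∫ x in (N * (u - θ / 2) / (1 - θ))..(N * (v - θ / 2) / (1 - θ)), h (ρ * g x) := by
  have hN' : (0 : ℝ) < N := by exact_mod_cast hN
  have hθ' : 0 < 1 - θ := by linarith
  rw [intervalIntegral.integral_of_le huv, integral_Ioc_eq_integral_Ioo,
    setIntegral_congr_fun measurableSet_Ioo
      (g := fun x => h (ρ * g ((N / (1 - θ)) * x - N * (θ / 2) / (1 - θ)))),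
    ← integral_Ioc_eq_integral_Ioo, ← intervalIntegral.integral_of_le huv,
    intervalIntegral.integral_comp_mul_sub (fun y => h (ρ * g y)) (by positivity)]
  · rw [smul_eq_mul, inv_div]
    congr 2 <;> ring
  · intro x hx
    have : Int.fract x = x := Int.fract_eq_self.2 ⟨by linarith [hx.1], by linarith [hx.2]⟩
    have h3 : ¬ (x ≤ θ / 2 ∨ 1 - θ / 2 ≤ x) := by
      rintro (h | h) <;> linarith [hx.1, hx.2]
    simp only [refineCell, this, h3, if_false]
    congr 3
    ring

theorem refineCell_integral_unit {h : ℝ → ℝ} (hm : Measurable h) (hc : ContinuousOn h (Ioi 0))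
    (hθ0 : 0 < θ) (hθ : θ < 1) (hρ : 0 < ρ) (hN : 0 < N) (hg : BddWeight g)
    (hp : Function.Periodic g 1) :
    ∫ x in (0 : ℝ)..1, h (refineCell θ ρ N g x) =
      θ * h 1 + (1 - θ) * ∫ x in (0 : ℝ)..1, h (ρ * g x) := by
  have hN' : (0 : ℝ) < N := by exact_mod_cast hN
  have hθ' : 1 - θ ≠ 0 := by linarith
  have hi := (refineCell_bddWeight (θ := θ) (N := N) hρ hg).intervalIntegrable_comp hm hc
  rw [← intervalIntegral.integral_add_adjacent_intervals (hi 0 (θ / 2)) (hi _ 1),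
    ← intervalIntegral.integral_add_adjacent_intervals (hi (θ / 2) (1 - θ / 2)) (hi _ 1),
    refineCell_integral_left h hθ le_rfl (by linarith) le_rfl,
    refineCell_integral_right h hθ le_rfl (by linarith) le_rfl,
    refineCell_integral_mid h hθ0 hθ hN le_rfl (by linarith) le_rfl]
  have e1 : (N : ℝ) * (θ / 2 - θ / 2) / (1 - θ) = 0 := by simp
  have e2 : (N : ℝ) * (1 - θ / 2 - θ / 2) / (1 - θ) = N := by
    field_simp
    ring
  rw [e1, e2, integral_periodic_nat (f := fun x => h (ρ * g x)) (fun x => by simp [hp x])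
    ((hg.const_mul hρ).intervalIntegrable_comp hm hc)]
  field_simp
  ring

end refine

theorem AdmissibleCell.exists_refinement {φ : ℝ → ℝ} {r θ ρ : ℝ} {g : ℝ → ℝ} (hr : 0 < r)
    (hm : Measurable φ) (hc : ContinuousOn φ (Ioi 0)) (hθ0 : 0 < θ) (hθ : θ < 1) (hρ : 0 < ρ)
    (hφr : φ r < 0) (hφρ : φ (r / ρ) ≤ 0) (hunit : ∫ x in (0 : ℝ)..1, φ (r * ρ * g x) ≤ 0)
    (hg : AdmissibleCell φ r g) :
    ∃ g' : ℝ → ℝ, AdmissibleCell φ r g' ∧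
      ∀ h : ℝ → ℝ, Measurable h → ContinuousOn h (Ioi 0) →
        ∫ x in (0 : ℝ)..1, h (g' x) = θ * h 1 + (1 - θ) * ∫ x in (0 : ℝ)..1, h (ρ * g x) := by
  have hrρ : 0 < r * ρ := mul_pos hr hρ
  have hg0 := hg.toBddWeight
  have hi0 := (hg0.const_mul hrρ).intervalIntegrable_comp hm hc
  obtain ⟨M, hM0, hM⟩ := (hg0.const_mul hrρ).exists_abs_comp_le hc
  have hbound : ∀ t, 0 ≤ t → ∫ x in (0 : ℝ)..t, φ (r * ρ * g x) ≤ M := by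
    intro t ht
    refine integral_periodic_le (f := fun x => φ (r * ρ * g x))
      (fun x => by simp [hg.periodic x]) hi0 hunit (fun s hs => ?_) ht
    have h1 := intervalIntegral.integral_mono_on hs.1 (hi0 0 s)
      (intervalIntegrable_const (c := M)) (fun x _ => (le_abs_self _).trans (hM x))
    refine h1.trans ?_
    simp only [intervalIntegral.integral_const, sub_zero, smul_eq_mul]
    exact mul_le_of_le_one_left hM0 hs.2
  obtain ⟨N, hN⟩ := exists_nat_gt (M / (-φ r * (θ / 2)))
  have hδ : 0 < -φ r * (θ / 2) := by nlinarith
  have hN' : (0 : ℝ) < N := (div_nonneg hM0 hδ.le).trans_lt hN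
  have hN0 : 0 < N := by exact_mod_cast hN'
  have hMN : M / N < -φ r * (θ / 2) := by
    rw [div_lt_iff₀ hδ] at hN
    rw [div_lt_iff₀ hN']
    linarith
  have hθ' : 0 < 1 - θ := by linarith
  set g' := refineCell θ ρ N g with hg'
  have hw : BddWeight g' := refineCell_bddWeight hρ hg0
  have hper : Function.Periodic g' 1 := refineCell_periodic
  have hiσ : ∀ {σ : ℝ}, 0 < σ → ∀ a b,
      IntervalIntegrable (fun x => φ (σ * g' x)) volume a b :=
    fun hσ => (hw.const_mul hσ).intervalIntegrable_comp hm hc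
  have hleft : ∀ {σ u v : ℝ}, 0 ≤ u → u ≤ v → v ≤ θ / 2 →
      ∫ x in u..v, φ (σ * g' x) = (v - u) * φ σ := fun hu huv hv => by
    simpa using refineCell_integral_left (ρ := ρ) (N := N) (g := g) (fun z => φ (_ * z)) hθ hu huv hv
  have hright : ∀ {σ u v : ℝ}, 1 - θ / 2 ≤ u → u ≤ v → v ≤ 1 →
      ∫ x in u..v, φ (σ * g' x) = (v - u) * φ σ := fun hu huv hv => by
    simpa using refineCell_integral_right (ρ := ρ) (N := N) (g := g) (fun z => φ (_ * z)) hθ hu huv hv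
  have hmid : ∀ {σ u v : ℝ}, θ / 2 ≤ u → u ≤ v → v ≤ 1 - θ / 2 →
      ∫ x in u..v, φ (σ * g' x) = (1 - θ) / N *
        ∫ x in (N * (u - θ / 2) / (1 - θ))..(N * (v - θ / 2) / (1 - θ)), φ (σ * (ρ * g x)) :=
    fun hu huv hv => refineCell_integral_mid (ρ := ρ) (g := g) (fun z => φ (_ * z)) hθ0 hθ hN0 hu huv hv
  have hanch : ∀ t ∈ Icc (0 : ℝ) 1, ∫ x in (0 : ℝ)..t, φ (r * g' x) ≤ 0 := by
    have hupto : ∀ t, θ / 2 ≤ t → t ≤ 1 - θ / 2 → ∫ x in (0 : ℝ)..t, φ (r * g' x) ≤ 0 := by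
      intro t h1 h2
      rw [← intervalIntegral.integral_add_adjacent_intervals (hiσ hr 0 (θ / 2)) (hiσ hr _ t),
        hleft le_rfl (by linarith) le_rfl, hmid le_rfl h1 h2]
      have h3 := hbound (N * (t - θ / 2) / (1 - θ))
        (div_nonneg (mul_nonneg hN'.le (by linarith)) hθ'.le)
      simp only [sub_self, mul_zero, zero_div, ← mul_assoc]
      have h4 : (1 - θ) / N * ∫ x in (0 : ℝ)..(N * (t - θ / 2) / (1 - θ)), φ (r * ρ * g x) ≤
          (1 - θ) / N * M := by gcongr
      have h5 : (1 - θ) / N * M ≤ M / N := by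
        rw [div_mul_eq_mul_div]
        gcongr
        nlinarith
      linarith
    intro t ht
    rcases le_total t (θ / 2) with h1 | h1
    · rw [hleft le_rfl ht.1 h1]
      nlinarith [ht.1]
    rcases le_total t (1 - θ / 2) with h2 | h2
    · exact hupto t h1 h2
    · rw [← intervalIntegral.integral_add_adjacent_intervals (hiσ hr 0 (1 - θ / 2)) (hiσ hr _ t),
        hright le_rfl h2 ht.2]
      have := hupto (1 - θ / 2) (by linarith) le_rfl
      nlinarith
  have hg'anch : ∀ t, 0 ≤ t → ∫ x in (0 : ℝ)..t, φ (r * g' x) ≤ 0 := fun t ht =>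
    integral_periodic_le (f := fun x => φ (r * g' x)) (fun x => by simp [hper x]) (hiσ hr)
      (hanch 1 ⟨zero_le_one, le_rfl⟩) hanch ht
  have heven : ∀ x, g' (-x) = g' x := refineCell_even hθ hg.periodic hg.even
  have hσ : 0 < r / ρ := div_pos hr hρ
  -- intervals inside the filled part with an endpoint on its boundary
  have hinner : ∀ u v, θ / 2 ≤ u → u ≤ v → v ≤ 1 - θ / 2 → (u = θ / 2 ∨ v = 1 - θ / 2) →
      ∫ x in u..v, φ (r / ρ * g' x) ≤ 0 := by
    intro u v hu huv hv hb
    rw [hmid hu huv hv]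
    refine mul_nonpos_of_nonneg_of_nonpos (by positivity) ?_
    have e1 : ∀ x, r / ρ * (ρ * g x) = r * g x := fun x => by field_simp
    simp only [e1]
    have hle : N * (u - θ / 2) / (1 - θ) ≤ N * (v - θ / 2) / (1 - θ) := by gcongr
    rcases hb with rfl | rfl
    · exact hg.integral_le_zero_of_int_mem hr hm hc (m := 0) (by simp) (by simpa using hle)
    · have e2 : (N : ℝ) * (1 - θ / 2 - θ / 2) / (1 - θ) = N := by
        field_simp
        ring
      rw [e2] at hle ⊢
      exact hg.integral_le_zero_of_int_mem hr hm hc (m := N) (by simpa using hle) (by simp)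
  have hunitcell : ∀ x y : ℝ, 0 ≤ x → x < y → y ≤ 1 →
      ∃ σ, 0 < σ ∧ ∫ z in x..y, φ (σ * g' z) ≤ 0 := by
    intro x y hx hxy hy
    rcases le_or_gt y (θ / 2) with h1 | h1
    · exact ⟨r, hr, by rw [hleft hx hxy.le h1]; nlinarith⟩
    rcases le_or_gt (1 - θ / 2) x with h2 | h2
    · exact ⟨r, hr, by rw [hright h2 hxy.le hy]; nlinarith⟩
    rcases lt_or_ge x (θ / 2) with h3 | h3
    · refine ⟨r / ρ, hσ, ?_⟩
      rw [← intervalIntegral.integral_add_adjacent_intervals (hiσ hσ x (θ / 2)) (hiσ hσ _ y),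
        hleft hx h3.le le_rfl]
      have h4 : (θ / 2 - x) * φ (r / ρ) ≤ 0 :=
        mul_nonpos_of_nonneg_of_nonpos (by linarith) hφρ
      rcases le_or_gt y (1 - θ / 2) with h5 | h5
      · linarith [hinner (θ / 2) y le_rfl h1.le h5 (Or.inl rfl)]
      · rw [← intervalIntegral.integral_add_adjacent_intervals (hiσ hσ (θ / 2) (1 - θ / 2))
          (hiσ hσ _ y), hright le_rfl h5.le hy]
        have h6 : (y - (1 - θ / 2)) * φ (r / ρ) ≤ 0 :=
          mul_nonpos_of_nonneg_of_nonpos (by linarith) hφρ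
        linarith [hinner (θ / 2) (1 - θ / 2) le_rfl (by linarith) le_rfl (Or.inl rfl)]
    rcases le_or_gt y (1 - θ / 2) with h5 | h5
    · obtain ⟨σ, hσ0, h⟩ := hg.rescaled (N * (x - θ / 2) / (1 - θ)) (N * (y - θ / 2) / (1 - θ))
        (by gcongr)
      refine ⟨σ / ρ, div_pos hσ0 hρ, ?_⟩
      rw [hmid h3 hxy.le h5]
      refine mul_nonpos_of_nonneg_of_nonpos (by positivity) ?_
      have e1 : ∀ x, σ / ρ * (ρ * g x) = σ * g x := fun x => by field_simp
      simpa only [e1] using h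
    · refine ⟨r / ρ, hσ, ?_⟩
      rw [← intervalIntegral.integral_add_adjacent_intervals (hiσ hσ x (1 - θ / 2)) (hiσ hσ _ y),
        hright le_rfl h5.le hy]
      have h6 : (y - (1 - θ / 2)) * φ (r / ρ) ≤ 0 :=
        mul_nonpos_of_nonneg_of_nonpos (by linarith) hφρ
      linarith [hinner x (1 - θ / 2) h3 h2.le le_rfl (Or.inr rfl)]
  refine ⟨g', ⟨hw, hper, heven, hg'anch, ?_⟩, fun h hhm hhc =>
    refineCell_integral_unit hhm hhc hθ0 hθ hρ hN0 hg0 hg.periodic⟩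
  intro x y hxy
  rcases le_or_gt y (⌊x⌋ + 1) with h1 | h1
  · obtain ⟨σ, hσ0, h⟩ := hunitcell (x - ⌊x⌋) (y - ⌊x⌋) (by linarith [Int.floor_le x])
      (by linarith) (by linarith)
    refine ⟨σ, hσ0, ?_⟩
    have h2 := intervalIntegral.integral_comp_add_right (a := x - ⌊x⌋) (b := y - ⌊x⌋)
      (fun z => φ (σ * g' z)) ⌊x⌋
    have h3 : ∀ z, g' (z + ⌊x⌋) = g' z := fun z => by simpa using hper.int_mul ⌊x⌋ z
    simp only [h3, sub_add_cancel] at h2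
    rwa [← h2]
  · exact ⟨r, hr, integral_periodic_even_le_zero (f := fun x => φ (r * g' x)) (m := ⌊x⌋ + 1)
      (fun x => by simp [hper x]) (fun x => by simp [heven x]) (hiσ hr) hg'anch
      (by push_cast; exact (Int.lt_floor_add_one x).le) (by push_cast; exact h1.le)⟩

/-- The functional whose nonpositive average over an interval, for some rescaling of the weight,
bounds the `A_p` quantity on that interval by `((1 + a) * (1 - a / (p - 1)) ^ (p - 1))⁻¹`. -/
def apFunctional (p a t : ℝ) : ℝ :=
  (1 + a) / p * t + (p - 1 - a) / p * t ^ (-1 / (p - 1)) - 1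

theorem measurable_apFunctional (p a : ℝ) : Measurable (apFunctional p a) := by
  unfold apFunctional
  fun_prop

theorem continuousOn_rpow_const_Ioi (e : ℝ) : ContinuousOn (fun t : ℝ => t ^ e) (Ioi 0) :=
  continuousOn_id.rpow_const fun _ hx => Or.inl (ne_of_gt hx)

theorem continuousOn_apFunctional (p a : ℝ) : ContinuousOn (apFunctional p a) (Ioi 0) := by
  unfold apFunctional
  exact (((continuousOn_const.mul continuousOn_id).add
    (continuousOn_const.mul (continuousOn_rpow_const_Ioi _))).sub continuousOn_const)

theorem integral_apFunctional {p a σ x y : ℝ} (hσ : 0 < σ) {w : ℝ → ℝ} (hw : ∀ z, 0 < w z)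
    (h1 : IntervalIntegrable w volume x y)
    (h2 : IntervalIntegrable (fun z => w z ^ (-1 / (p - 1))) volume x y) :
    ∫ z in x..y, apFunctional p a (σ * w z) =
      (1 + a) / p * σ * (∫ z in x..y, w z) +
        (p - 1 - a) / p * σ ^ (-1 / (p - 1)) * (∫ z in x..y, w z ^ (-1 / (p - 1))) - (y - x) := by
  have e : ∀ z, apFunctional p a (σ * w z) = (1 + a) / p * σ * w z +
      (p - 1 - a) / p * σ ^ (-1 / (p - 1)) * w z ^ (-1 / (p - 1)) - 1 := fun z => by
    rw [apFunctional, Real.mul_rpow hσ.le (hw z).le]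
    ring
  simp only [e]
  rw [intervalIntegral.integral_sub ((h1.const_mul _).add (h2.const_mul _))
    intervalIntegrable_const, intervalIntegral.integral_add (h1.const_mul _) (h2.const_mul _),
    intervalIntegral.integral_const_mul, intervalIntegral.integral_const_mul]
  simp

theorem ApChar_le_of_integral_apFunctional_nonpos {p a Q : ℝ} (hp : 1 < p) (ha0 : 0 < a)
    (ha : a < p - 1) (hQ : Q * ((1 + a) * (1 - a / (p - 1)) ^ (p - 1)) = 1) {w : ℝ → ℝ}
    (hw : ∀ z, 0 < w z) {σ x y : ℝ} (hxy : x < y) (hσ : 0 < σ)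
    (h1 : IntervalIntegrable w volume x y)
    (h2 : IntervalIntegrable (fun z => w z ^ (-1 / (p - 1))) volume x y)
    (h : ∫ z in x..y, apFunctional p a (σ * w z) ≤ 0) : ApChar w p x y ≤ Q := by
  have hp1 : 0 < p - 1 := by linarith
  have hp0 : 0 < p := by linarith
  have hyx : 0 < y - x := by linarith
  rw [integral_apFunctional hσ hw h1 h2] at h
  rw [ApChar, intAvg_eq_intervalIntegral hxy, intAvg_eq_intervalIntegral hxy]
  set I := ∫ z in x..y, w z
  set J := ∫ z in x..y, w z ^ (-1 / (p - 1))
  have hI : 0 ≤ I := intervalIntegral.integral_nonneg hxy.le fun z _ => (hw z).le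
  have hJ : 0 ≤ J :=
    intervalIntegral.integral_nonneg hxy.le fun z _ => Real.rpow_nonneg (hw z).le _
  set X := (y - x)⁻¹ * I with hX
  set Y := (y - x)⁻¹ * J with hY
  have hX0 : 0 ≤ X := by positivity
  have hY0 : 0 ≤ Y := by positivity
  have ha' : 0 < 1 - a / (p - 1) := by
    rw [sub_pos, div_lt_one hp1]; exact ha
  have hb : 1 / p * ((1 + a) * σ * X) +
      (p - 1) / p * ((1 - a / (p - 1)) * σ ^ (-1 / (p - 1)) * Y) ≤ 1 := by
    have : 1 / p * ((1 + a) * σ * X) +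
        (p - 1) / p * ((1 - a / (p - 1)) * σ ^ (-1 / (p - 1)) * Y) =
        (y - x)⁻¹ * ((1 + a) / p * σ * I + (p - 1 - a) / p * σ ^ (-1 / (p - 1)) * J) := by
      rw [hX, hY]
      field_simp
    rw [this, inv_mul_le_one₀ hyx]
    linarith
  have hg := Real.geom_mean_le_arith_mean2_weighted (w₁ := 1 / p) (w₂ := (p - 1) / p)
    (by positivity) (by positivity) (p₁ := (1 + a) * σ * X)
    (p₂ := (1 - a / (p - 1)) * σ ^ (-1 / (p - 1)) * Y) (by positivity) (by positivity)
    (by field_simp; ring)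
  have hg1 := Real.rpow_le_rpow (by positivity) (hg.trans hb) hp0.le
  have hs : (σ ^ (-1 / (p - 1))) ^ (p - 1) = σ⁻¹ := by
    rw [← Real.rpow_mul hσ.le, div_mul_cancel₀ _ hp1.ne', Real.rpow_neg_one]
  rw [Real.one_rpow, Real.mul_rpow (by positivity) (by positivity), ← Real.rpow_mul (by positivity),
    ← Real.rpow_mul (by positivity), div_mul_cancel₀ _ hp0.ne', div_mul_cancel₀ _ hp0.ne',
    Real.rpow_one, Real.mul_rpow (by positivity) hY0, Real.mul_rpow ha'.le (by positivity), hs] at hg1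
  have hD : 0 < (1 + a) * (1 - a / (p - 1)) ^ (p - 1) := by positivity
  have : X * Y ^ (p - 1) * ((1 + a) * (1 - a / (p - 1)) ^ (p - 1)) ≤
      Q * ((1 + a) * (1 - a / (p - 1)) ^ (p - 1)) := by
    rw [hQ]
    convert hg1 using 1
    field_simp
  exact le_of_mul_le_mul_right this hD

theorem ApChar_const_mul {p r x y : ℝ} (hp : 1 < p) (hr : 0 < r) (hxy : x < y) {w : ℝ → ℝ}
    (hw : ∀ z, 0 < w z) : ApChar (fun z => r * w z) p x y = ApChar w p x y := by
  have hp1 : 0 < p - 1 := by linarith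
  have e : ∀ z, (r * w z) ^ (-1 / (p - 1)) = r ^ (-1 / (p - 1)) * w z ^ (-1 / (p - 1)) :=
    fun z => Real.mul_rpow hr.le (hw z).le
  have hJ : 0 ≤ ∫ z in x..y, w z ^ (-1 / (p - 1)) :=
    intervalIntegral.integral_nonneg hxy.le fun z _ => Real.rpow_nonneg (hw z).le _
  simp only [ApChar, intAvg_eq_intervalIntegral hxy, e, intervalIntegral.integral_const_mul]
  have hs : (r ^ (-1 / (p - 1))) ^ (p - 1) = r⁻¹ := by
    rw [← Real.rpow_mul hr.le, div_mul_cancel₀ _ hp1.ne', Real.rpow_neg_one]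
  have hyx : 0 ≤ (y - x)⁻¹ := by rw [inv_nonneg]; linarith
  rw [mul_left_comm _ (r ^ (-1 / (p - 1))), Real.mul_rpow (by positivity) (by positivity), hs]
  field_simp

theorem exists_admissibleCell_moments {p a r θ ρ X Y d L : ℝ} (ha0 : 0 < a)
    (ha : a < p - 1) (hr : 0 < r) (hθ0 : 0 < θ) (hθ : θ < 1) (hρ : 0 < ρ)
    (hφr : apFunctional p a r < 0) (hφρ : apFunctional p a (r / ρ) ≤ 0) (hX0 : 0 < X)
    (hX : X = θ + (1 - θ) * ρ * X) (hY : Y = θ + (1 - θ) * ρ ^ (-1 / (p - 1)) * Y)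
    (hXY : X ^ (-1 / (p - 1)) ≤ Y)
    (h1 : (1 + a) / p * r * X + (p - 1 - a) / p * r ^ (-1 / (p - 1)) * Y ≤ 1)
    (h2 : (1 + a) / p * (r * ρ) * X + (p - 1 - a) / p * (r * ρ) ^ (-1 / (p - 1)) * Y ≤ 1)
    (hL : L = θ + (1 - θ) * ρ ^ d * L) (n : ℕ) :
    ∃ g : ℝ → ℝ, AdmissibleCell (apFunctional p a) r g ∧ ∫ x in (0 : ℝ)..1, g x = X ∧
      ∫ x in (0 : ℝ)..1, g x ^ (-1 / (p - 1)) =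
        Y - ((1 - θ) * ρ ^ (-1 / (p - 1))) ^ n * (Y - X ^ (-1 / (p - 1))) ∧
      ∫ x in (0 : ℝ)..1, g x ^ d = L - ((1 - θ) * ρ ^ d) ^ n * (L - X ^ d) := by
  have hp0 : 0 < p := by linarith
  have hB : 0 ≤ p - 1 - a := by linarith
  have hm := measurable_apFunctional p a
  have hc := continuousOn_apFunctional p a
  induction n with
  | zero =>
    have hneg : apFunctional p a (r * X) ≤ 0 := by
      rw [apFunctional, Real.mul_rpow hr.le hX0.le]
      have : (p - 1 - a) / p * (r ^ (-1 / (p - 1)) * X ^ (-1 / (p - 1))) ≤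
          (p - 1 - a) / p * (r ^ (-1 / (p - 1)) * Y) := by gcongr
      linarith
    refine ⟨fun _ => X, ⟨⟨measurable_const, X, X, hX0, fun _ => ⟨le_rfl, le_rfl⟩⟩, fun _ => rfl,
      fun _ => rfl, fun t ht => ?_, fun x y hxy => ⟨r, hr, ?_⟩⟩, by simp, by simp, by simp⟩
    · simpa using mul_nonpos_of_nonneg_of_nonpos ht hneg
    · simpa using mul_nonpos_of_nonneg_of_nonpos (sub_nonneg.2 hxy.le) hneg
  | succ n ih =>
    obtain ⟨g, hg, gX, gY, gL⟩ := ih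
    have hg0 := hg.toBddWeight
    have hunit : ∫ x in (0 : ℝ)..1, apFunctional p a (r * ρ * g x) ≤ 0 := by
      rw [integral_apFunctional (mul_pos hr hρ) hg0.pos
        (hg0.intervalIntegrable_comp measurable_id continuousOn_id 0 1)
        (hg0.intervalIntegrable_comp (measurable_id.pow_const _)
          (continuousOn_rpow_const_Ioi _) 0 1), gX, gY]
      have : (p - 1 - a) / p * (r * ρ) ^ (-1 / (p - 1)) *
          (Y - ((1 - θ) * ρ ^ (-1 / (p - 1))) ^ n * (Y - X ^ (-1 / (p - 1)))) ≤
          (p - 1 - a) / p * (r * ρ) ^ (-1 / (p - 1)) * Y := by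
        have h3 : 0 ≤ ((1 - θ) * ρ ^ (-1 / (p - 1))) ^ n * (Y - X ^ (-1 / (p - 1))) :=
          mul_nonneg (pow_nonneg (mul_nonneg (by linarith) (by positivity)) n) (by linarith)
        gcongr
        linarith
      linarith
    obtain ⟨g', hg', hpint⟩ := hg.exists_refinement hr hm hc hθ0 hθ hρ hφr hφρ hunit
    have hpow : ∀ e : ℝ, ∫ x in (0 : ℝ)..1, g' x ^ e =
        θ + (1 - θ) * ρ ^ e * ∫ x in (0 : ℝ)..1, g x ^ e := fun e => by
      rw [hpint (fun t => t ^ e) (measurable_id.pow_const e) (continuousOn_rpow_const_Ioi e)]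
      have : ∀ x, (ρ * g x) ^ e = ρ ^ e * g x ^ e := fun x => Real.mul_rpow hρ.le (hg0.pos x).le
      simp only [this, intervalIntegral.integral_const_mul, Real.one_rpow]
      ring
    refine ⟨g', hg', ?_, ?_, ?_⟩
    · have := hpow 1
      simp only [Real.rpow_one] at this
      rw [this, gX, ← hX]
    · rw [hpow, gY, pow_succ]
      linear_combination -hY
    · rw [hpow, gL, pow_succ]
      linear_combination -hL

theorem tendsto_div_one_sub_rpow {m : ℝ} (hm : m ≠ 0) :
    Tendsto (fun θ : ℝ => θ / (1 - (1 - θ) ^ m)) (nhdsWithin 0 (Ioi 0)) (nhds (1 / m)) := by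
  have h1 : HasDerivAt (fun θ : ℝ => 1 - (1 - θ) ^ m) m 0 := by
    have h2 : HasDerivAt (fun θ : ℝ => 1 - θ) (-1) 0 := by
      simpa using (hasDerivAt_id (0 : ℝ)).const_sub 1
    have h3 := (h2.rpow_const (p := m) (Or.inl (by norm_num))).const_sub 1
    simpa using h3
  have h4 := (hasDerivAt_iff_tendsto_slope.1 h1).mono_left
    (nhdsWithin_mono 0 (fun x (hx : (0 : ℝ) < x) => hx.ne'))
  have h5 := h4.inv₀ hm
  rw [one_div]
  refine h5.congr fun θ => ?_
  simp [slope_def_field]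

theorem eventually_apFunctional_neg {p a : ℝ} (hp : 1 < p) (ha0 : 0 < a) :
    ∀ᶠ r in nhdsWithin 1 (Iio 1), apFunctional p a r < 0 := by
  have hp1 : 0 < p - 1 := by linarith
  have hp0 : 0 < p := by linarith
  have h1 : HasDerivAt (apFunctional p a)
      ((1 + a) / p + (p - 1 - a) / p * (-1 / (p - 1))) 1 := by
    have h2 := ((Real.hasDerivAt_rpow_const (x := 1) (p := -1 / (p - 1))
      (Or.inl one_ne_zero)).const_mul ((p - 1 - a) / p))
    have h3 := (((hasDerivAt_id (1 : ℝ)).const_mul ((1 + a) / p)).add h2).sub_const 1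
    rw [Real.one_rpow, mul_one, mul_one] at h3
    exact h3
  have hpos : 0 < (1 + a) / p + (p - 1 - a) / p * (-1 / (p - 1)) := by
    have : (1 + a) / p + (p - 1 - a) / p * (-1 / (p - 1)) = a / (p - 1) := by
      field_simp
      ring
    rw [this]
    positivity
  have h4 := (hasDerivAt_iff_tendsto_slope.1 h1).mono_left
    (nhdsWithin_mono 1 (fun x (hx : x < (1 : ℝ)) => hx.ne))
  have hone : apFunctional p a 1 = 0 := by
    simp only [apFunctional, Real.one_rpow]
    field_simp
    ring
  filter_upwards [h4.eventually_const_lt hpos, self_mem_nhdsWithin] with r hr hr1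
  rw [slope_def_field, hone, sub_zero] at hr
  have hr1' : r - 1 < 0 := by linarith [show r < 1 from hr1]
  by_contra! hcon
  exact absurd hr (not_lt.2 (div_nonpos_of_nonneg_of_nonpos hcon hr1'.le))

theorem exists_exponent {p a Q Q' T : ℝ} (ha0 : 0 < a) (ha : a < p - 1)
    (hQ : Q * ((1 + a) * (1 - a / (p - 1)) ^ (p - 1)) = 1) (hQ' : Q' < Q) :
    ∃ b, 0 < b ∧ b < a ∧ T < 1 / (1 - b / a) ∧
      Q' < 1 / (1 + b) * (1 / (1 - b / (p - 1))) ^ (p - 1) := by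
  have hp1 : 0 < p - 1 := by linarith
  have ha' : 0 < 1 - a / (p - 1) := by rw [sub_pos, div_lt_one hp1]; exact ha
  have h1 : ∀ᶠ b in nhdsWithin a (Iio a), 0 < b :=
    nhdsWithin_le_nhds (eventually_gt_nhds ha0)
  have h2 : ∀ᶠ b in nhdsWithin a (Iio a), T < 1 / (1 - b / a) := by
    have h : Tendsto (fun b : ℝ => 1 - b / a) (nhdsWithin a (Iio a)) (nhdsWithin 0 (Ioi 0)) := by
      refine tendsto_nhdsWithin_iff.2 ⟨?_, ?_⟩
      · have : ContinuousAt (fun b : ℝ => 1 - b / a) a := by fun_prop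
        have h := this.tendsto
        simp only [div_self ha0.ne', sub_self] at h
        exact h.mono_left nhdsWithin_le_nhds
      · filter_upwards [self_mem_nhdsWithin] with b hb
        simpa [div_lt_one ha0] using hb
    simpa using (tendsto_inv_nhdsGT_zero.comp h).eventually_gt_atTop T
  have h3 : ∀ᶠ b in nhdsWithin a (Iio a),
      Q' < 1 / (1 + b) * (1 / (1 - b / (p - 1))) ^ (p - 1) := by
    refine nhdsWithin_le_nhds ?_
    have hc : ContinuousAt (fun b : ℝ => 1 / (1 + b) * (1 / (1 - b / (p - 1))) ^ (p - 1)) a := by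
      refine ContinuousAt.mul ?_ (ContinuousAt.rpow_const ?_ (Or.inr hp1.le))
      · exact continuousAt_const.div (by fun_prop) (by positivity)
      · exact continuousAt_const.div (by fun_prop) ha'.ne'
    refine hc.tendsto.eventually_const_lt (hQ'.trans_eq ?_)
    rw [Real.div_rpow zero_le_one ha'.le, Real.one_rpow]
    have hD := Real.rpow_pos_of_pos ha' (p - 1)
    generalize (1 - a / (p - 1)) ^ (p - 1) = D at hQ hD ⊢
    field_simp
    linarith
  obtain ⟨b, hb1, hb2, hb3, hb4⟩ := (h1.and (h2.and (h3.and self_mem_nhdsWithin))).exists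
  exact ⟨b, hb1, hb4, hb2, hb3⟩

theorem apFunctional_power_mean_lt {p a b : ℝ} (hb0 : 0 < b) (hb : b < a) (ha : a < p - 1) :
    (1 + a) / p * (1 / (1 + b)) + (p - 1 - a) / p * (1 / (1 - b / (p - 1))) < 1 := by
  have hp1 : 0 < p - 1 := by linarith
  have hp0 : 0 < p := by linarith
  have h1 : 0 < p - 1 - b := by linarith
  have e : 1 / (1 - b / (p - 1)) = (p - 1) / (p - 1 - b) := by
    field_simp
  rw [e, div_mul_div_comm, div_mul_div_comm, div_add_div _ _ (by positivity) (by positivity),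
    div_lt_one (by positivity)]
  have : 0 < p * (p * (b * (a - b))) := by
    have : 0 < a - b := by linarith
    positivity
  nlinarith

theorem one_div_rpow_lt {p b : ℝ} (hb0 : 0 < b) (hb : b < p - 1) :
    (1 / (1 + b)) ^ (-1 / (p - 1)) < 1 / (1 - b / (p - 1)) := by
  have hp1 : 0 < p - 1 := by linarith
  have hb' : 0 < 1 - b / (p - 1) := by rw [sub_pos, div_lt_one hp1]; exact hb
  have h1 : (1 / (1 + b)) ^ (-1 / (p - 1)) = (1 + b) ^ (1 / (p - 1)) := by
    rw [one_div, Real.inv_rpow (by positivity), neg_div, Real.rpow_neg (by positivity), inv_inv]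
  have h2 : (1 + b) ^ (1 / (p - 1)) ≤ Real.exp (b / (p - 1)) := by
    have := Real.rpow_le_rpow (by positivity) (Real.add_one_le_exp b) (z := 1 / (p - 1))
      (by positivity)
    rw [← Real.exp_mul] at this
    rw [add_comm]
    simpa [div_eq_mul_inv] using this
  have h3 : 1 - b / (p - 1) < Real.exp (-(b / (p - 1))) := by
    have := Real.add_one_lt_exp (x := -(b / (p - 1))) (by simp; constructor <;> positivity)
    linarith
  rw [h1]
  refine h2.trans_lt ?_
  rw [lt_one_div (Real.exp_pos _) hb', one_div, ← Real.exp_neg]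
  exact h3

theorem exists_admissibleCell {p a Q Q' T : ℝ} (ha0 : 0 < a) (ha : a < p - 1)
    (hQ : Q * ((1 + a) * (1 - a / (p - 1)) ^ (p - 1)) = 1) (hQ' : Q' < Q) :
    ∃ r, 0 < r ∧ ∃ g : ℝ → ℝ, AdmissibleCell (apFunctional p a) r g ∧
      Q' < ApChar g p 0 1 ∧ T < ApChar g (1 + a) 0 1 := by
  have hp : 1 < p := by linarith
  have hp1 : 0 < p - 1 := by linarith
  obtain ⟨S, hS0, hS⟩ : ∃ S : ℝ, 0 < S ∧ T < 1 / (1 + a) * S ^ a := by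
    have h1 : Tendsto (fun S : ℝ => 1 / (1 + a) * S ^ a) atTop atTop :=
      (tendsto_rpow_atTop ha0).const_mul_atTop (by positivity)
    obtain ⟨S, h⟩ := ((eventually_gt_atTop 0).and (h1.eventually_gt_atTop T)).exists
    exact ⟨S, h⟩
  obtain ⟨b, hb0, hb, hbS, hbQ⟩ := exists_exponent (T := S) ha0 ha hQ hQ'
  have hbp : b < p - 1 := hb.trans ha
  have hb' : 0 < 1 - b / (p - 1) := by rw [sub_pos, div_lt_one hp1]; exact hbp
  have hba : 0 < 1 - b / a := by rw [sub_pos, div_lt_one ha0]; exact hb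
  have hlt := apFunctional_power_mean_lt hb0 hb ha
  obtain ⟨r, hr0, hφr, hrlt⟩ : ∃ r : ℝ, 0 < r ∧ apFunctional p a r < 0 ∧
      (1 + a) / p * r * (1 / (1 + b)) +
        (p - 1 - a) / p * r ^ (-1 / (p - 1)) * (1 / (1 - b / (p - 1))) < 1 := by
    have h1 : ∀ᶠ r : ℝ in nhdsWithin 1 (Iio 1), 0 < r :=
      nhdsWithin_le_nhds (eventually_gt_nhds one_pos)
    have h2 : ∀ᶠ r : ℝ in nhdsWithin 1 (Iio 1), (1 + a) / p * r * (1 / (1 + b)) +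
        (p - 1 - a) / p * r ^ (-1 / (p - 1)) * (1 / (1 - b / (p - 1))) < 1 := by
      refine nhdsWithin_le_nhds ?_
      have hc : ContinuousAt (fun r : ℝ => (1 + a) / p * r * (1 / (1 + b)) +
          (p - 1 - a) / p * r ^ (-1 / (p - 1)) * (1 / (1 - b / (p - 1)))) 1 := by
        have := Real.continuousAt_rpow_const 1 (-1 / (p - 1)) (Or.inl one_ne_zero)
        fun_prop
      exact hc.tendsto.eventually_lt_const (by simpa using hlt)
    obtain ⟨r, h⟩ := (h1.and ((eventually_apFunctional_neg hp ha0).and h2)).exists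
    exact ⟨r, h⟩
  set e := -1 / (p - 1) with he
  have hX := tendsto_div_one_sub_rpow (m := 1 + b) (by positivity)
  have hY := tendsto_div_one_sub_rpow hb'.ne'
  have hL := tendsto_div_one_sub_rpow hba.ne'
  set X : ℝ → ℝ := fun θ => θ / (1 - (1 - θ) ^ (1 + b))
  set Y : ℝ → ℝ := fun θ => θ / (1 - (1 - θ) ^ (1 - b / (p - 1)))
  set L : ℝ → ℝ := fun θ => θ / (1 - (1 - θ) ^ (1 - b / a))
  have hρ : Tendsto (fun θ : ℝ => (1 - θ) ^ b) (nhdsWithin 0 (Ioi 0)) (nhds 1) := by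
    have hc : ContinuousAt (fun θ : ℝ => (1 - θ) ^ b) 0 :=
      ContinuousAt.rpow_const (by fun_prop) (Or.inr hb0.le)
    have := hc.tendsto
    simp only [sub_zero, Real.one_rpow] at this
    exact this.mono_left nhdsWithin_le_nhds
  have hrρ := hρ.const_mul r
  rw [mul_one] at hrρ
  have E1 : ∀ᶠ θ in nhdsWithin (0 : ℝ) (Ioi 0), θ < 1 :=
    nhdsWithin_le_nhds (eventually_lt_nhds one_pos)
  have E2 : ∀ᶠ θ in nhdsWithin (0 : ℝ) (Ioi 0), apFunctional p a (r / (1 - θ) ^ b) < 0 := by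
    have h1 : Tendsto (fun θ : ℝ => r / (1 - θ) ^ b) (nhdsWithin 0 (Ioi 0)) (nhds r) := by
      have h := (tendsto_const_nhds (x := r)).div hρ one_ne_zero
      rw [div_one] at h
      exact h
    have h2 := ((continuousOn_apFunctional p a).continuousAt (Ioi_mem_nhds hr0)).tendsto.comp h1
    exact h2.eventually_lt_const hφr
  have E3 : ∀ᶠ θ in nhdsWithin (0 : ℝ) (Ioi 0),
      (1 + a) / p * r * X θ + (p - 1 - a) / p * r ^ e * Y θ < 1 :=
    ((hX.const_mul _).add (hY.const_mul _)).eventually_lt_const hrlt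
  have E4 : ∀ᶠ θ in nhdsWithin (0 : ℝ) (Ioi 0), (1 + a) / p * (r * (1 - θ) ^ b) * X θ +
      (p - 1 - a) / p * (r * (1 - θ) ^ b) ^ e * Y θ < 1 :=
    (((hrρ.const_mul _).mul hX).add (((hrρ.rpow_const (Or.inl hr0.ne')).const_mul _).mul
      hY)).eventually_lt_const hrlt
  have E5 : ∀ᶠ θ in nhdsWithin (0 : ℝ) (Ioi 0), X θ ^ e < Y θ :=
    (hX.rpow_const (Or.inl (by positivity))).eventually_lt hY (one_div_rpow_lt hb0 hbp)
  have E6 : ∀ᶠ θ in nhdsWithin (0 : ℝ) (Ioi 0), Q' < X θ * Y θ ^ (p - 1) :=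
    (hX.mul (hY.rpow_const (Or.inr hp1.le))).eventually_const_lt hbQ
  have E7 : ∀ᶠ θ in nhdsWithin (0 : ℝ) (Ioi 0), S < L θ := hL.eventually_const_lt hbS
  have E8 : ∀ᶠ θ in nhdsWithin (0 : ℝ) (Ioi 0), 1 / (1 + a) < X θ :=
    hX.eventually_const_lt (one_div_lt_one_div_of_lt (by positivity) (by linarith))
  obtain ⟨θ, hθ, e2, e3, e4, e5, e6, e7, e8, hθ0⟩ := (E1.and (E2.and (E3.and (E4.and
    (E5.and (E6.and (E7.and (E8.and self_mem_nhdsWithin)))))))).exists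
  replace hθ0 : 0 < θ := hθ0
  have hθ' : 0 < 1 - θ := by linarith
  have hκ : ∀ c : ℝ, 0 < c → (1 - θ) ^ c < 1 := fun c hc =>
    Real.rpow_lt_one hθ'.le (by linarith) hc
  have hfix : ∀ c : ℝ, 0 < c →
      θ / (1 - (1 - θ) ^ c) = θ + (1 - θ) ^ c * (θ / (1 - (1 - θ) ^ c)) := fun c hc => by
    have : 1 - (1 - θ) ^ c ≠ 0 := by linarith [hκ c hc]
    field_simp
    ring
  have hmulpow : ∀ c : ℝ, (1 - θ) * ((1 - θ) ^ b) ^ c = (1 - θ) ^ (1 + b * c) := fun c => by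
    rw [Real.rpow_add hθ', Real.rpow_one, Real.rpow_mul hθ'.le]
  have hpX : (1 - θ) * (1 - θ) ^ b = (1 - θ) ^ (1 + b) := by
    simpa using hmulpow 1
  have hpY : (1 - θ) * ((1 - θ) ^ b) ^ e = (1 - θ) ^ (1 - b / (p - 1)) := by
    rw [hmulpow, he]; congr 1; ring
  have hpL : (1 - θ) * ((1 - θ) ^ b) ^ (-1 / a) = (1 - θ) ^ (1 - b / a) := by
    rw [hmulpow]; congr 1; ring
  have hX0 : 0 < X θ := (show (0 : ℝ) < 1 / (1 + a) by positivity).trans e8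
  have hcell := exists_admissibleCell_moments (p := p) (d := -1 / a) (L := L θ) ha0 ha hr0 hθ0 hθ
    (Real.rpow_pos_of_pos hθ' b) hφr e2.le hX0 (by rw [hpX]; exact hfix _ (by positivity))
    (by rw [hpY]; exact hfix _ hb') e5.le e3.le e4.le (by rw [hpL]; exact hfix _ hba)
  rw [← he, hpY, hpL] at hcell
  have hpow : ∀ c : ℝ, 0 < c → ∀ A B : ℝ,
      Tendsto (fun n : ℕ => A - ((1 - θ) ^ c) ^ n * B) atTop (nhds A) := fun c hc A B => by
    have := ((tendsto_pow_atTop_nhds_zero_of_lt_one (Real.rpow_nonneg hθ'.le c)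
      (hκ c hc)).mul_const B).const_sub A
    simpa using this
  have F1 := (((hpow _ hb' (Y θ) (Y θ - X θ ^ e)).rpow_const
    (Or.inr hp1.le)).const_mul (X θ)).eventually_const_lt e6
  have F2 := (hpow _ hba (L θ) (L θ - X θ ^ (-1 / a))).eventually_const_lt e7
  obtain ⟨n, f1, f2⟩ := (F1.and F2).exists
  obtain ⟨g, hg, gX, gY, gL⟩ := hcell n
  refine ⟨r, hr0, g, hg, ?_, ?_⟩
  · simp only [ApChar, intAvg_eq_intervalIntegral one_pos, sub_zero, inv_one, one_mul]
    rw [gX, ← he, gY]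
    exact f1
  · simp only [ApChar, intAvg_eq_intervalIntegral one_pos, sub_zero, inv_one, one_mul,
      add_sub_cancel_left]
    rw [gX, gL]
    refine hS.trans_le ?_
    gcongr

/-- On `[m, m + 1)` the weight `G |m|`. -/
def glueCells (G : ℕ → ℝ → ℝ) (x : ℝ) : ℝ := G ⌊x⌋.natAbs x

theorem glueCells_measurable {G : ℕ → ℝ → ℝ} (hG : ∀ m, Measurable (G m)) :
    Measurable (glueCells G) := by
  have h : Measurable fun q : ℝ × ℕ => G q.2 q.1 := measurable_from_prod_countable_left hG
  exact h.comp (measurable_id.prodMk ((measurable_of_countable Int.natAbs).comp Int.measurable_floor))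

section glue

variable {G : ℕ → ℝ → ℝ}

theorem integral_comp_glueCells (h : ℝ → ℝ) {m : ℤ} {x y : ℝ} (hx : m ≤ x) (hxy : x ≤ y)
    (hy : y ≤ m + 1) :
    ∫ z in x..y, h (glueCells G z) = ∫ z in x..y, h (G m.natAbs z) := by
  rw [intervalIntegral.integral_of_le hxy, intervalIntegral.integral_of_le hxy,
    integral_Ioc_eq_integral_Ioo, integral_Ioc_eq_integral_Ioo]
  refine setIntegral_congr_fun measurableSet_Ioo fun z hz => ?_
  have : ⌊z⌋ = m := Int.floor_eq_iff.2 ⟨by linarith [hz.1], by linarith [hz.2]⟩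
  simp [glueCells, this]

theorem intervalIntegrable_comp_glueCells (hG : ∀ m, BddWeight (G m)) {h : ℝ → ℝ}
    (hm : Measurable h) (hc : ContinuousOn h (Ioi 0)) (a b : ℝ) :
    IntervalIntegrable (fun z => h (glueCells G z)) volume a b := by
  have hunit : ∀ m : ℤ, IntervalIntegrable (fun z => h (glueCells G z)) volume m (m + 1) := by
    intro m
    refine ((hG m.natAbs).intervalIntegrable_comp hm hc m (m + 1)).congr_ae ?_
    rw [uIoc_of_le (by linarith), ← restrict_Ioo_eq_restrict_Ioc]
    refine ae_restrict_of_forall_mem measurableSet_Ioo fun z hz => ?_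
    have : ⌊z⌋ = m := Int.floor_eq_iff.2 ⟨hz.1.le, hz.2⟩
    simp [glueCells, this]
  have hnat : ∀ (m : ℤ) (n : ℕ),
      IntervalIntegrable (fun z => h (glueCells G z)) volume m ((m + n : ℤ) : ℝ) := by
    intro m n
    induction n with
    | zero => simp
    | succ n ih =>
      refine ih.trans ?_
      have := hunit (m + n)
      push_cast at this ⊢
      rwa [← add_assoc]
  obtain ⟨n, hn⟩ := exists_nat_ge (max |a| |b|)
  have h1 : |a| ≤ n := (le_max_left _ _).trans hn
  have h2 : |b| ≤ n := (le_max_right _ _).trans hn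
  have := hnat (-n) (n + n)
  push_cast at this
  rw [neg_add_cancel_left] at this
  refine this.mono_set ?_
  have h0 : -(n : ℝ) ≤ n := by linarith [abs_nonneg a]
  rw [uIcc_of_le h0]
  exact uIcc_subset_Icc (abs_le.1 h1) (abs_le.1 h2)

theorem integral_comp_glueCells_nonpos {φ : ℝ → ℝ} (hm : Measurable φ)
    (hc : ContinuousOn φ (Ioi 0)) (hG : ∀ m, AdmissibleCell φ 1 (G m)) {m : ℤ} {x y : ℝ}
    (hx : x ≤ m) (hy : m ≤ y) : ∫ z in x..y, φ (glueCells G z) ≤ 0 := by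
  have hi := intervalIntegrable_comp_glueCells (fun m => (hG m).toBddWeight) hm hc
  have hcell : ∀ (k l : ℤ) (x y : ℝ), k ≤ x → x ≤ y → y ≤ k + 1 → x ≤ l → l ≤ y →
      ∫ z in x..y, φ (glueCells G z) ≤ 0 := by
    intro k l x y h1 h2 h3 h4 h5
    rw [integral_comp_glueCells φ h1 h2 h3]
    simpa using (hG k.natAbs).integral_le_zero_of_int_mem one_pos hm hc h4 h5
  have hR : ∀ (n : ℕ) (k : ℤ) (y : ℝ), k ≤ y → y ≤ k + n + 1 →
      ∫ z in (k : ℝ)..y, φ (glueCells G z) ≤ 0 := by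
    intro n
    induction n with
    | zero => intro k y h1 h2; exact hcell k k k y le_rfl h1 (by simpa using h2) le_rfl h1
    | succ n ih =>
      intro k y h1 h2
      rcases le_total y (k + 1) with h3 | h3
      · exact hcell k k k y le_rfl h1 h3 le_rfl h1
      · rw [← intervalIntegral.integral_add_adjacent_intervals (hi k (k + 1)) (hi _ y)]
        have h4 := hcell k k k (k + 1) le_rfl (by linarith) le_rfl le_rfl (by linarith)
        have h5 := ih (k + 1) y (by push_cast; exact h3) (by push_cast at h2 ⊢; linarith)
        push_cast at h5
        linarith
  have hL : ∀ (n : ℕ) (k : ℤ) (x : ℝ), x ≤ k → k - n - 1 ≤ x →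
      ∫ z in x..(k : ℝ), φ (glueCells G z) ≤ 0 := by
    intro n
    induction n with
    | zero =>
      intro k x h1 h2
      exact hcell (k - 1) k x k (by push_cast; simpa using h2) h1 (by push_cast; linarith) h1 le_rfl
    | succ n ih =>
      intro k x h1 h2
      have h0 : ∀ x : ℝ, x ≤ k → (k : ℝ) - 1 ≤ x → ∫ z in x..(k : ℝ), φ (glueCells G z) ≤ 0 :=
        fun x h1 h2 => hcell (k - 1) k x k (by push_cast; exact h2) h1 (by push_cast; linarith)
          h1 le_rfl
      rcases le_total (k - 1 : ℝ) x with h3 | h3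
      · exact h0 x h1 h3
      · rw [← intervalIntegral.integral_add_adjacent_intervals (hi x (k - 1)) (hi _ k)]
        have h4 := h0 (k - 1) (by linarith) le_rfl
        have h5 := ih (k - 1) x (by push_cast; exact h3) (by push_cast at h2 ⊢; linarith)
        push_cast at h5
        linarith
  rw [← intervalIntegral.integral_add_adjacent_intervals (hi x m) (hi _ y)]
  have h1 := hR ⌈y - m⌉₊ m y hy (by linarith [Nat.le_ceil (y - m)])
  have h2 := hL ⌈m - x⌉₊ m x hx (by linarith [Nat.le_ceil (m - x)])
  linarith

theorem exists_integral_comp_glueCells_nonpos {φ : ℝ → ℝ} (hm : Measurable φ)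
    (hc : ContinuousOn φ (Ioi 0)) (hG : ∀ m, AdmissibleCell φ 1 (G m)) {x y : ℝ} (hxy : x < y) :
    ∃ σ, 0 < σ ∧ ∫ z in x..y, φ (σ * glueCells G z) ≤ 0 := by
  rcases le_or_gt y (⌊x⌋ + 1) with h1 | h1
  · obtain ⟨σ, hσ, h⟩ := (hG ⌊x⌋.natAbs).rescaled x y hxy
    refine ⟨σ, hσ, ?_⟩
    rwa [integral_comp_glueCells (fun t => φ (σ * t)) (Int.floor_le x) hxy.le h1]
  · refine ⟨1, one_pos, ?_⟩
    simp only [one_mul]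
    exact integral_comp_glueCells_nonpos hm hc hG (m := ⌊x⌋ + 1)
      (by push_cast; exact (Int.lt_floor_add_one x).le) (by push_cast; exact h1.le)

theorem ApChar_glueCells (q : ℝ) (n : ℕ) (hG : Function.Periodic (G n) 1) :
    ApChar (glueCells G) q n (n + 1) = ApChar (G n) q 0 1 := by
  have key : ∀ h : ℝ → ℝ, ∫ z in (n : ℝ)..(n + 1), h (glueCells G z) =
      ∫ z in (0 : ℝ)..1, h (G n z) := by
    intro h
    have h1 := integral_comp_glueCells (G := G) h (m := n) (x := n) (y := n + 1) (by simp)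
      (by linarith) (by simp)
    rw [h1, Int.natAbs_natCast]
    have hp : Function.Periodic (fun z => h (G n z)) 1 := fun z => by simp [hG z]
    simpa using hp.intervalIntegral_add_eq n 0
  simp only [ApChar, intAvg_eq_intervalIntegral (show (n : ℝ) < n + 1 by linarith),
    intAvg_eq_intervalIntegral (zero_lt_one (α := ℝ)), key (fun t => t),
    key (fun t => t ^ (-1 / (q - 1)))]
  simp

end glue

theorem AdmissibleCell.const_mul {φ : ℝ → ℝ} {r : ℝ} {g : ℝ → ℝ} (hr : 0 < r)
    (hg : AdmissibleCell φ r g) : AdmissibleCell φ 1 (fun x => r * g x) where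
  toBddWeight := hg.toBddWeight.const_mul hr
  periodic x := by simp [hg.periodic x]
  even x := by simp [hg.even x]
  anchored t ht := by simpa using hg.anchored t ht
  rescaled x y hxy := by
    obtain ⟨σ, hσ, h⟩ := hg.rescaled x y hxy
    refine ⟨σ / r, div_pos hσ hr, ?_⟩
    have e : ∀ z, σ / r * (r * g z) = σ * g z := fun z => by field_simp
    simpa only [e] using h

/-- Sharpness of the range `q > 1 - s⁻_{p1}(Q)` in `A_p ⊂ A_q` on the
real line: there is a weight with `[w]_p = Q` and `[w]_{q₀} = ∞` for `q₀ = 1 - s⁻_{p1}(Q)`. -/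
theorem Ap_to_Aq_sharpness
    (p Q p1 : ℝ) (hp : 1 < p) (hQ : 1 < Q) (hp1 : p1 = -1 / (p - 1))
    (sm : ℝ) (hsm_mem : sm ∈ Icc (1 / p1) 0)
    (hsm : (1 - sm) * (1 - p1 * sm) ^ (-1 / p1) = 1 / Q)
    (q₀ : ℝ) (hq₀ : q₀ = 1 - sm) :
    ∃ w : ℝ → ℝ, Measurable w ∧ (∀ᵐ x ∂(volume : Measure ℝ), 0 < w x) ∧
      MemAp w p Q ∧
      (∀ Q' : ℝ, Q' < Q → ∃ a b : ℝ, a < b ∧ Q' < ApChar w p a b) ∧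
      ¬ ∃ C : ℝ, MemAp w q₀ C := by
  have hp1' : 0 < p - 1 := by linarith
  subst hp1 hq₀
  obtain ⟨a, rfl⟩ : ∃ a, sm = -a := ⟨-sm, by ring⟩
  have e1 : -1 / (-1 / (p - 1)) = p - 1 := by field_simp
  have e2 : 1 / (-1 / (p - 1)) = -(p - 1) := by field_simp
  have e3 : 1 - -1 / (p - 1) * -a = 1 - a / (p - 1) := by ring
  rw [e1, e3, sub_neg_eq_add] at hsm
  rw [e2] at hsm_mem
  have hQ0 : 0 < Q := by linarith
  have ha0 : 0 < a := by
    rcases (neg_nonpos.1 hsm_mem.2).lt_or_eq with h | h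
    · exact h
    · rw [← h] at hsm
      norm_num at hsm
      linarith
  have ha : a < p - 1 := by
    rcases (neg_le_neg_iff.1 hsm_mem.1).lt_or_eq with h | h
    · exact h
    · rw [h, div_self hp1'.ne', sub_self, Real.zero_rpow hp1'.ne', mul_zero] at hsm
      have : 0 < 1 / Q := by positivity
      linarith
  have hQ' : Q * ((1 + a) * (1 - a / (p - 1)) ^ (p - 1)) = 1 := by
    rw [hsm]; field_simp
  have hcells : ∀ m : ℕ, ∃ g : ℝ → ℝ, AdmissibleCell (apFunctional p a) 1 g ∧
      Q - 1 / (m + 1) < ApChar g p 0 1 ∧ (m : ℝ) < ApChar g (1 + a) 0 1 := by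
    intro m
    obtain ⟨r, hr, g, hg, h1, h2⟩ := exists_admissibleCell (Q' := Q - 1 / (m + 1)) (T := m) ha0 ha
      hQ' (sub_lt_self _ (by positivity))
    refine ⟨fun x => r * g x, hg.const_mul hr, ?_, ?_⟩
    · rwa [ApChar_const_mul hp hr one_pos hg.pos]
    · rwa [ApChar_const_mul (by linarith) hr one_pos hg.pos]
  choose G hG hG1 hG2 using hcells
  have hpos : ∀ x, 0 < glueCells G x := fun x => (hG _).pos x
  have hpint : ∀ e x y : ℝ, IntervalIntegrable (fun z => glueCells G z ^ e) volume x y :=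
    fun e => intervalIntegrable_comp_glueCells (fun m => (hG m).toBddWeight)
      (measurable_id.pow_const e) (continuousOn_rpow_const_Ioi e)
  have hwint : ∀ x y : ℝ, IntervalIntegrable (glueCells G) volume x y := fun x y => by
    simpa using hpint 1 x y
  refine ⟨glueCells G, glueCells_measurable fun m => (hG m).measurable,
    Eventually.of_forall hpos, fun x y hxy => ⟨?_, ?_, ?_⟩, fun Q' hlt => ?_, ?_⟩
  · exact (intervalIntegrable_iff_integrableOn_Ioo_of_le hxy.le).1 (hwint x y)
  · exact (intervalIntegrable_iff_integrableOn_Ioo_of_le hxy.le).1 (hpint _ x y)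
  · obtain ⟨σ, hσ, h⟩ := exists_integral_comp_glueCells_nonpos (measurable_apFunctional p a)
      (continuousOn_apFunctional p a) hG hxy
    exact ApChar_le_of_integral_apFunctional_nonpos hp ha0 ha hQ' hpos hxy hσ (hwint x y)
      (hpint _ x y) h
  · obtain ⟨n, hn⟩ := exists_nat_one_div_lt (sub_pos.2 hlt)
    refine ⟨n, n + 1, by linarith, ?_⟩
    rw [ApChar_glueCells p n (hG n).periodic]
    linarith [hG1 n]
  · rintro ⟨C, hC⟩
    obtain ⟨n, hn⟩ := exists_nat_ge C
    have h := (hC n (n + 1) (by linarith)).2.2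
    rw [ApChar_glueCells _ n (hG n).periodic, sub_neg_eq_add] at h
    linarith [hG2 n]
end
end
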